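/- For all integers l ≥ 1, m ≥ 1 and all x ≥ y in ℝ, lim_{n→∞} P( M̂_n^{(l)} ≤ u_n(x), M_n^{(m)} ≤ u_n(y) ) = ∑_{t=0}^{m−1} ∑_{i=0}^{m−t−1} ∑_{j=0}^{min{i, l−1}} E ∫_{−∞}^{+∞} [ (λ g(y,z))^t / t! · exp(−g(y,z)) · ((1−λ) g(x,z))^j / j! · ((1−λ)(g(y,z) − g(x,z)))^{i−j} / (i−j)! ] dΦ(z). -/

import Mathlib

open MeasureTheory ProbabilityTheory Filter Real
open scoped Classical NNReal ENNReal

/-- The normalizing levels `u_n(x) = x/a_n + b_n` with `a_n = (2 ln n)^{1/2}` and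
`b_n = a_n - (ln ln n + ln (4π))/(2 a_n)`. -/
noncomputable def un (n : ℕ) (x : ℝ) : ℝ :=
  x / Real.sqrt (2 * Real.log n) +
    (Real.sqrt (2 * Real.log n) -
      (Real.log (Real.log n) + Real.log (4 * Real.pi)) / (2 * Real.sqrt (2 * Real.log n)))

/-- `g(x,z) = exp(-x - γ + √(2γ) z)`. -/
noncomputable def g (γ x z : ℝ) : ℝ := Real.exp (-x - γ + Real.sqrt (2 * γ) * z)

/-- **Stein's identity** for a centered real Gaussian law. -/
lemma integral_id_mul_gaussianReal (v : ℝ≥0) {h h' : ℝ → ℝ} (hd : ∀ w, HasDerivAt h (h' w) w)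
    (hm : Measurable h') {C C' : ℝ} (hC : ∀ w, |h w| ≤ C) (hC' : ∀ w, |h' w| ≤ C') :
    ∫ w, w * h w ∂(gaussianReal 0 v) = v * ∫ w, h' w ∂(gaussianReal 0 v) := by
  rcases eq_or_ne v 0 with rfl | hv
  · simp
  have hv' : (v : ℝ) ≠ 0 := by exact_mod_cast hv
  have hcont : Continuous h := continuous_iff_continuousAt.2 fun w => (hd w).continuousAt
  have hpd : ∀ w, HasDerivAt (gaussianPDFReal 0 v) (-(w / v) * gaussianPDFReal 0 v w) w := by
    intro w
    rw [gaussianPDFReal_def]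
    have h1 : HasDerivAt (fun x : ℝ => -(x - 0) ^ 2 / (2 * (v : ℝ))) (-(w / v)) w := by
      have := (((hasDerivAt_id w).sub_const 0).pow 2).neg.div_const (2 * (v : ℝ))
      refine this.congr_deriv ?_
      simp; field_simp
    refine (h1.exp.const_mul ((√(2 * π * v))⁻¹)).congr_deriv ?_
    ring
  have hid : Integrable (fun w : ℝ => w) (gaussianReal 0 v) :=
    (memLp_id_gaussianReal 1).integrable (by simp)
  have e1 : Integrable (fun w => w * h w) (gaussianReal 0 v) :=
    hid.mul_bdd (c := C) hcont.aestronglyMeasurable (ae_of_all _ fun w => by simpa using hC w)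
  have e2 : Integrable h' (gaussianReal 0 v) :=
    (integrable_const C').mono' hm.aestronglyMeasurable (ae_of_all _ fun w => by simpa using hC' w)
  have key : ∀ {f : ℝ → ℝ}, Integrable f (gaussianReal 0 v) →
      Integrable (fun w => gaussianPDFReal 0 v w * f w) := by
    intro f hf
    rw [gaussianReal_of_var_ne_zero _ hv, integrable_withDensity_iff_integrable_smul'
      (measurable_gaussianPDF _ _) (ae_of_all _ fun _ => gaussianPDF_lt_top)] at hf
    simpa [toReal_gaussianPDF] using hf
  have i0 : Integrable (fun w => gaussianPDFReal 0 v w * h w) :=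
    key ((integrable_const C).mono' hcont.aestronglyMeasurable
      (ae_of_all _ fun w => by simpa using hC w))
  have i1 := key e1
  have i2 := key e2
  rw [integral_gaussianReal_eq_integral_smul hv, integral_gaussianReal_eq_integral_smul hv]
  simp only [smul_eq_mul]
  have := integral_eq_zero_of_hasDerivAt_of_integrable
    (f := fun w => gaussianPDFReal 0 v w * h w)
    (f' := fun w => gaussianPDFReal 0 v w * h' w - (v : ℝ)⁻¹ * (gaussianPDFReal 0 v w * (w * h w)))
    (fun w => by
      refine ((hpd w).mul (hd w)).congr_deriv ?_
      field_simp; ring) (i2.sub (i1.const_mul _)) i0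
  rw [integral_sub i2 (i1.const_mul _), integral_const_mul] at this
  have h3 : ∫ w, gaussianPDFReal 0 v w * h' w
      = (v : ℝ)⁻¹ * ∫ w, gaussianPDFReal 0 v w * (w * h w) := by linarith
  rw [h3]; field_simp

/-- Gaussian integration by parts for a product of functions of jointly Gaussian variables. -/
lemma integral_mul_prod_of_hasGaussianLaw {Ω ι : Type*} [MeasurableSpace Ω] {P : Measure Ω}
    [IsProbabilityMeasure P] [Fintype ι] {W : Ω → ℝ} {Z : ι → Ω → ℝ}
    (hG : HasGaussianLaw (fun ω => (W ω, fun i => Z i ω)) P)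
    (hWm : Measurable W) (hZm : ∀ i, Measurable (Z i)) (hW0 : ∫ ω, W ω ∂P = 0)
    {ψ ψ' : ι → ℝ → ℝ} {C : ℝ} (hψm : ∀ j, Measurable (ψ j)) (hψm' : ∀ j, Measurable (ψ' j))
    (hC : ∀ j w, |ψ j w| ≤ C) (hC' : ∀ j w, |ψ' j w| ≤ C)
    (hd : ∀ j, cov[W, Z j; P] ≠ 0 → ∀ w, HasDerivAt (ψ j) (ψ' j w) w) :
    ∫ ω, W ω * ∏ j, ψ j (Z j ω) ∂P =
      ∑ j, cov[W, Z j; P] *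
        ∫ ω, (∏ k ∈ Finset.univ.erase j, ψ k (Z k ω)) * ψ' j (Z j ω) ∂P := by
  have hWL : MemLp W 2 P := hG.fst.memLp_two
  have hZL : ∀ i, MemLp (Z i) 2 P := fun i => (hG.snd.eval i).memLp_two
  rcases eq_or_ne Var[W; P] 0 with h0 | h0
  · have hW : W =ᵐ[P] 0 := by
      have := ae_eq_integral_of_variance_eq_zero hWL h0
      filter_upwards [this] with ω hω
      simpa [hW0] using hω
    have hc : ∀ j, cov[W, Z j; P] = 0 := fun j => by
      have h2 : ∀ᵐ ω ∂P, (W ω - P[W]) * (Z j ω - P[Z j]) = 0 := by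
        filter_upwards [hW] with ω hω
        simp [hω, hW0]
      rw [covariance, integral_congr_ae h2]; simp
    simp only [hc, zero_mul, Finset.sum_const_zero]
    rw [integral_congr_ae (g := fun _ => 0)]
    · simp
    · filter_upwards [hW] with ω hω
      simp [hω]
  set s := Var[W; P] with hs
  set c : ι → ℝ := fun j => cov[W, Z j; P] with hc
  have hspos : 0 < s := lt_of_le_of_ne (variance_nonneg _ _) (Ne.symm h0)
  set R : ι → Ω → ℝ := fun j ω => Z j ω - c j / s * W ω with hR
  have hRm : ∀ j, Measurable (R j) := fun j => (hZm j).sub (hWm.const_mul _)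
  have hGR : HasGaussianLaw (fun ω => (fun (_ : Unit) => W ω, fun i => R i ω)) P := by
    let L : (ℝ × (ι → ℝ)) →L[ℝ] ((Unit → ℝ) × (ι → ℝ)) :=
      (ContinuousLinearMap.pi fun _ => ContinuousLinearMap.fst ℝ ℝ (ι → ℝ)).prod
        (ContinuousLinearMap.pi fun j =>
          (ContinuousLinearMap.proj j).comp (ContinuousLinearMap.snd ℝ ℝ (ι → ℝ)) -
            (c j / s) • ContinuousLinearMap.fst ℝ ℝ (ι → ℝ))
    exact hG.map_fun L
  have hind : W ⟂ᵢ[P] fun ω j => R j ω := by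
    have := HasGaussianLaw.indepFun_of_covariance_eval (X := fun (_ : Unit) => W) hGR ?_
    · exact this.comp (φ := fun x : Unit → ℝ => x ()) (ψ := id)
        (by fun_prop) measurable_id
    · intro _ j
      have : R j = Z j - fun ω => c j / s * W ω := rfl
      rw [this, covariance_sub_right hWL (hZL j) (hWL.const_mul _), covariance_const_mul_right,
        covariance_self hWm.aemeasurable, ← hs]
      simp only [hc]
      field_simp
      simp
  have hmap := (indepFun_iff_map_prod_eq_prod_map_map hWm.aemeasurable
    (measurable_pi_lambda _ hRm).aemeasurable).1 hind
  have hmapW : P.map W = gaussianReal 0 s.toNNReal := by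
    rw [hG.fst.map_eq_gaussianReal, hW0]
  set μ := P.map (fun ω j => R j ω) with hμ
  have : IsProbabilityMeasure μ := Measure.isProbabilityMeasure_map (measurable_pi_lambda _ hRm).aemeasurable
  rw [hmapW] at hmap
  have hint : ∀ {F : ℝ × (ι → ℝ) → ℝ}, Measurable F →
      Integrable F ((gaussianReal 0 s.toNNReal).prod μ) →
      ∫ ω, F (W ω, fun j => R j ω) ∂P = ∫ r, ∫ w, F (w, r) ∂(gaussianReal 0 s.toNNReal) ∂μ := by
    intro F hF hFi
    rw [← integral_prod_symm F hFi, ← hmap, integral_map (by fun_prop) hF.aestronglyMeasurable]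
  have hZR : ∀ j ω, Z j ω = R j ω + c j / s * W ω := fun j ω => by simp [hR]
  have hCn : ∀ j w, |ψ j w| ≤ max C 1 := fun j w => (hC j w).trans (le_max_left _ _)
  have hprodb : ∀ (t : Finset ι) (w : ι → ℝ), |∏ k ∈ t, ψ k (w k)| ≤ (max C 1) ^ t.card := by
    intro t w
    rw [Finset.abs_prod]
    exact (Finset.prod_le_prod (fun _ _ => abs_nonneg _) fun k _ => hCn k _).trans (by simp)
  have hid : Integrable (fun w : ℝ => w) (gaussianReal 0 s.toNNReal) :=
    (memLp_id_gaussianReal 1).integrable (by simp)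
  have hDb : ∀ j (w : ι → ℝ), |(∏ k ∈ Finset.univ.erase j, ψ k (w k)) * ψ' j (w j)|
      ≤ (max C 1) ^ (Finset.univ.erase j).card * C := by
    intro j w
    rw [abs_mul]
    exact mul_le_mul (hprodb _ _) (hC' _ _) (abs_nonneg _) (by positivity)
  have lhs : ∫ ω, W ω * ∏ j, ψ j (Z j ω) ∂P =
      ∫ r, ∫ w, w * ∏ j, ψ j (r j + c j / s * w) ∂(gaussianReal 0 s.toNNReal) ∂μ := by
    rw [← hint (F := fun p => p.1 * ∏ j, ψ j (p.2 j + c j / s * p.1))]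
    · simp only [← hZR]
    · fun_prop
    · refine Integrable.mul_bdd (c := (max C 1) ^ (Finset.univ : Finset ι).card) ?_ ?_ ?_
      · exact hid.comp_fst μ
      · exact Measurable.aestronglyMeasurable (by fun_prop)
      · exact ae_of_all _ fun p => hprodb _ _
  have rhs : ∀ j, ∫ ω, (∏ k ∈ Finset.univ.erase j, ψ k (Z k ω)) * ψ' j (Z j ω) ∂P =
      ∫ r, ∫ w, (∏ k ∈ Finset.univ.erase j, ψ k (r k + c k / s * w)) * ψ' j (r j + c j / s * w)
        ∂(gaussianReal 0 s.toNNReal) ∂μ := by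
    intro j
    rw [← hint (F := fun p => (∏ k ∈ Finset.univ.erase j, ψ k (p.2 k + c k / s * p.1)) *
      ψ' j (p.2 j + c j / s * p.1))]
    · simp only [← hZR]
    · fun_prop
    · refine (integrable_const _).mono' (Measurable.aestronglyMeasurable (by fun_prop))
        (ae_of_all _ fun p => hDb j _)
  have hDint : ∀ j (r : ι → ℝ), Integrable (fun w => (∏ k ∈ Finset.univ.erase j,
      ψ k (r k + c k / s * w)) * ψ' j (r j + c j / s * w)) (gaussianReal 0 s.toNNReal) := by
    intro j r
    refine (integrable_const _).mono' (Measurable.aestronglyMeasurable (by fun_prop))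
        (ae_of_all _ fun p => hDb j _)
  have inner : ∀ r : ι → ℝ,
      ∫ w, w * ∏ j, ψ j (r j + c j / s * w) ∂(gaussianReal 0 s.toNNReal) =
      ∑ j, c j * ∫ w, (∏ k ∈ Finset.univ.erase j, ψ k (r k + c k / s * w)) *
        ψ' j (r j + c j / s * w) ∂(gaussianReal 0 s.toNNReal) := by
    intro r
    rw [integral_id_mul_gaussianReal s.toNNReal
      (h' := fun w => ∑ j, (∏ k ∈ Finset.univ.erase j, ψ k (r k + c k / s * w)) *
        (ψ' j (r j + c j / s * w) * (c j / s)))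
      (C := (max C 1) ^ (Finset.univ : Finset ι).card)
      (C' := ∑ j, (max C 1) ^ (Finset.univ.erase j).card * C * |c j / s|)]
    · rw [integral_finsetSum]
      · rw [Real.coe_toNNReal _ hspos.le, Finset.mul_sum]
        refine Finset.sum_congr rfl fun j _ => ?_
        simp only [← mul_assoc]
        rw [integral_mul_const]
        rw [mul_comm s, mul_assoc, div_mul_cancel₀ _ hspos.ne', mul_comm]
      · intro j _
        simpa [mul_assoc] using (hDint j r).mul_const (c j / s)
    · intro w
      refine HasDerivAt.fun_finsetProd fun j _ => ?_
      by_cases hj : c j = 0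
      · simpa [hj] using hasDerivAt_const w (ψ j (r j))
      · have h1 : HasDerivAt (fun w => r j + c j / s * w) (c j / s) w := by
          simpa using ((hasDerivAt_id w).const_mul (c j / s)).const_add (r j)
        exact (hd j hj _).comp w h1
    · fun_prop
    · intro w; exact hprodb _ _
    · intro w
      refine (Finset.abs_sum_le_sum_abs _ _).trans (Finset.sum_le_sum fun j _ => ?_)
      rw [← mul_assoc, abs_mul]
      exact mul_le_mul_of_nonneg_right (hDb j _) (abs_nonneg _)
  rw [lhs]
  simp only [inner]
  rw [integral_finsetSum]
  · refine Finset.sum_congr rfl fun j _ => ?_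
    rw [integral_const_mul, rhs]
  · intro j _
    refine Integrable.const_mul ?_ _
    refine Integrable.integral_prod_right (f := fun p : ℝ × (ι → ℝ) =>
      (∏ k ∈ Finset.univ.erase j, ψ k (p.2 k + c k / s * p.1)) *
      ψ' j (p.2 j + c j / s * p.1)) ?_
    exact (integrable_const _).mono' (Measurable.aestronglyMeasurable (by fun_prop))
        (ae_of_all _ fun p => hDb j _)

/-- Comparison of the expectations of a smooth product functional at two independent Gaussian
vectors with the same variances, by interpolation along a rotation. -/
lemma abs_integral_prod_sub_integral_prod_le {Ω ι : Type*} [MeasurableSpace Ω] {P : Measure Ω}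
    [IsProbabilityMeasure P] [Fintype ι] {U V : ι → Ω → ℝ}
    (hG : HasGaussianLaw (fun ω => (fun i => U i ω, fun i => V i ω)) P)
    (hUm : ∀ i, Measurable (U i)) (hVm : ∀ i, Measurable (V i))
    (hU0 : ∀ i, ∫ ω, U i ω ∂P = 0) (hV0 : ∀ i, ∫ ω, V i ω ∂P = 0)
    (hUV : ∀ i j, cov[U i, V j; P] = 0) (hvar : ∀ i, cov[U i, U i; P] = cov[V i, V i; P])
    {φ φ' : ι → ℝ → ℝ} {C : ℝ} (hφm' : ∀ j, Measurable (φ' j))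
    (hφ : ∀ j w, |φ j w| ≤ 1) (hφ' : ∀ j w, |φ' j w| ≤ C)
    (hd : ∀ j w, HasDerivAt (φ j) (φ' j w) w) {B : ι → ι → ℝ}
    (hB : ∀ i j, i ≠ j → ∀ θ : ℝ,
      ∫ ω, |φ' i (sin θ * U i ω + cos θ * V i ω)| * |φ' j (sin θ * U j ω + cos θ * V j ω)| ∂P
        ≤ B i j) :
    |∫ ω, ∏ j, φ j (U j ω) ∂P - ∫ ω, ∏ j, φ j (V j ω) ∂P| ≤
      (∑ i, ∑ j ∈ Finset.univ.erase i, |cov[U i, U j; P] - cov[V i, V j; P]| * B i j) * (π / 2) := by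
  have hcont : ∀ j, Continuous (φ j) := fun j =>
    continuous_iff_continuousAt.2 fun w => (hd j w).continuousAt
  have hφm : ∀ j, Measurable (φ j) := fun j => (hcont j).measurable
  have hUL : ∀ i, MemLp (U i) 2 P := fun i => (hG.fst.eval i).memLp_two
  have hVL : ∀ i, MemLp (V i) 2 P := fun i => (hG.snd.eval i).memLp_two
  have hUi : ∀ i, Integrable (U i) P := fun i => (hUL i).integrable (by norm_num)
  have hVi : ∀ i, Integrable (V i) P := fun i => (hVL i).integrable (by norm_num)
  set Z : ℝ → ι → Ω → ℝ := fun θ i ω => sin θ * U i ω + cos θ * V i ω with hZ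
  set W : ℝ → ι → Ω → ℝ := fun θ i ω => cos θ * U i ω - sin θ * V i ω with hW
  have hZm : ∀ θ i, Measurable (Z θ i) := fun θ i => by simp only [hZ]; fun_prop
  have hWm : ∀ θ i, Measurable (W θ i) := fun θ i => by simp only [hW]; fun_prop
  have hprodb : ∀ (t : Finset ι) (w : ι → ℝ), |∏ k ∈ t, φ k (w k)| ≤ 1 := by
    intro t w
    rw [Finset.abs_prod]
    exact Finset.prod_le_one (fun _ _ => abs_nonneg _) fun k _ => hφ k _
  have hcov : ∀ θ i j, cov[W θ i, Z θ j; P] =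
      sin θ * cos θ * (cov[U i, U j; P] - cov[V i, V j; P]) := by
    intro θ i j
    have e1 : W θ i = (fun ω => cos θ * U i ω) - fun ω => sin θ * V i ω := rfl
    have e2 : Z θ j = (fun ω => sin θ * U j ω) + fun ω => cos θ * V j ω := rfl
    rw [e1, e2, covariance_sub_left ((hUL i).const_mul _) ((hVL i).const_mul _)
      (((hUL j).const_mul _).add ((hVL j).const_mul _)),
      covariance_add_right ((hUL i).const_mul _) ((hUL j).const_mul _) ((hVL j).const_mul _),
      covariance_add_right ((hVL i).const_mul _) ((hUL j).const_mul _) ((hVL j).const_mul _)]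
    simp only [covariance_const_mul_left, covariance_const_mul_right, hUV]
    rw [covariance_comm (V i) (U j), hUV]
    ring
  have hGWZ : ∀ θ i, HasGaussianLaw (fun ω => (W θ i ω, fun j => Z θ j ω)) P := by
    intro θ i
    let L : ((ι → ℝ) × (ι → ℝ)) →L[ℝ] (ℝ × (ι → ℝ)) :=
      (cos θ • (ContinuousLinearMap.proj i).comp (ContinuousLinearMap.fst ℝ (ι → ℝ) (ι → ℝ)) -
        sin θ • (ContinuousLinearMap.proj i).comp (ContinuousLinearMap.snd ℝ (ι → ℝ) (ι → ℝ))).prod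
        (sin θ • ContinuousLinearMap.fst ℝ (ι → ℝ) (ι → ℝ) +
          cos θ • ContinuousLinearMap.snd ℝ (ι → ℝ) (ι → ℝ))
    exact hG.map_fun L
  have hW0 : ∀ θ i, ∫ ω, W θ i ω ∂P = 0 := by
    intro θ i
    simp only [hW]
    rw [integral_sub ((hUi i).const_mul _) ((hVi i).const_mul _), integral_const_mul,
      integral_const_mul, hU0, hV0]
    simp
  have hC0 : ∀ i : ι, 0 ≤ C := fun i => (abs_nonneg _).trans (hφ' i 0)
  set D : ι → ℝ → Ω → ℝ := fun i θ ω =>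
    (∏ j ∈ Finset.univ.erase i, φ j (Z θ j ω)) * (φ' i (Z θ i ω) * W θ i ω) with hD
  have hDbound : ∀ i θ ω, |D i θ ω| ≤ C * (|U i ω| + |V i ω|) := by
    intro i θ ω
    simp only [hD, abs_mul]
    have h1 : |W θ i ω| ≤ |U i ω| + |V i ω| := by
      simp only [hW]
      refine (abs_sub _ _).trans ?_
      rw [abs_mul, abs_mul]
      exact add_le_add (mul_le_of_le_one_left (abs_nonneg _) (abs_cos_le_one _))
        (mul_le_of_le_one_left (abs_nonneg _) (abs_sin_le_one _))
    calc _ ≤ 1 * (C * (|U i ω| + |V i ω|)) := by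
            refine mul_le_mul (hprodb _ _) ?_ (by positivity) zero_le_one
            exact mul_le_mul (hφ' _ _) h1 (abs_nonneg _) (hC0 i)
      _ = _ := one_mul _
  have hDbi : ∀ i, Integrable (fun ω => C * (|U i ω| + |V i ω|)) P := fun i =>
    ((hUi i).abs.add (hVi i).abs).const_mul C
  have hDm : ∀ i θ, Measurable (D i θ) := fun i θ => by
    simp only [hD, hZ, hW]; fun_prop
  have hDint : ∀ i θ, Integrable (D i θ) P := fun i θ =>
    (hDbi i).mono' (hDm i θ).aestronglyMeasurable (ae_of_all _ fun ω => hDbound i θ ω)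
  set F : ℝ → ℝ := fun θ => ∫ ω, ∏ j, φ j (Z θ j ω) ∂P with hF
  have hder : ∀ θ, HasDerivAt F (∑ i, ∫ ω, D i θ ω ∂P) θ := by
    intro θ
    rw [← integral_finsetSum _ fun i _ => hDint i θ]
    refine (hasDerivAt_integral_of_dominated_loc_of_deriv_le (s := Set.univ)
      (F := fun θ ω => ∏ j, φ j (Z θ j ω)) (F' := fun θ ω => ∑ i, D i θ ω)
      (bound := fun ω => ∑ i, C * (|U i ω| + |V i ω|)) univ_mem
      (Eventually.of_forall fun θ => ?_) ?_ ?_ ?_ ?_ ?_).2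
    · exact Measurable.aestronglyMeasurable (by simp only [hZ]; fun_prop)
    · exact (integrable_const 1).mono'
        (Measurable.aestronglyMeasurable (by simp only [hZ]; fun_prop))
        (ae_of_all _ fun ω => hprodb _ _)
    · exact (Finset.measurable_sum _ fun i _ => hDm i θ).aestronglyMeasurable
    · exact ae_of_all _ fun ω θ _ => (Finset.abs_sum_le_sum_abs _ _).trans
        (Finset.sum_le_sum fun i _ => hDbound i θ ω)
    · exact integrable_finsetSum _ fun i _ => hDbi i
    · refine ae_of_all _ fun ω θ _ => ?_
      refine HasDerivAt.fun_finsetProd fun j _ => ?_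
      have h1 : HasDerivAt (fun θ => Z θ j ω) (W θ j ω) θ := by
        refine (((hasDerivAt_sin θ).mul_const (U j ω)).add
          ((hasDerivAt_cos θ).mul_const (V j ω))).congr_deriv ?_
        simp only [hW]; ring
      exact (hd j _).comp θ h1
  have hDle : ∀ i θ, |∫ ω, D i θ ω ∂P| ≤
      ∑ j ∈ Finset.univ.erase i, |cov[U i, U j; P] - cov[V i, V j; P]| * B i j := by
    intro i θ
    have hibp := integral_mul_prod_of_hasGaussianLaw (hGWZ θ i) (hWm θ i) (hZm θ) (hW0 θ i)
      (ψ := fun j => if j = i then φ' i else φ j) (ψ' := fun j => if j = i then 0 else φ' j)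
      (C := max C 1) (fun j => by split_ifs <;> fun_prop)
      (fun j => by
        split_ifs
        · exact measurable_zero
        · fun_prop)
      (fun j w => by
        split_ifs
        · exact (hφ' _ _).trans (le_max_left _ _)
        · exact (hφ _ _).trans (le_max_right _ _))
      (fun j w => by
        split_ifs
        · simp
        · exact (hφ' _ _).trans (le_max_left _ _))
      (fun j hj w => by
        by_cases hji : j = i
        · subst hji
          exact absurd (by rw [hcov, hvar]; ring) hj
        · simpa [hji] using hd j w)
    have hφe : ∀ (t : Finset ι), i ∉ t → ∀ w : ι → ℝ,
        ∏ j ∈ t, (if j = i then φ' i else φ j) (w j) = ∏ j ∈ t, φ j (w j) := fun t ht w =>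
      Finset.prod_congr rfl fun j hj => by rw [if_neg (ne_of_mem_of_not_mem hj ht)]
    have e : ∫ ω, D i θ ω ∂P =
        ∫ ω, W θ i ω * ∏ j, (if j = i then φ' i else φ j) (Z θ j ω) ∂P := by
      refine integral_congr_ae (ae_of_all _ fun ω => ?_)
      simp only [hD]
      rw [← Finset.mul_prod_erase Finset.univ _ (Finset.mem_univ i), if_pos rfl]
      rw [hφe _ (Finset.notMem_erase i _)]
      ring
    rw [e, hibp, ← Finset.add_sum_erase _ _ (Finset.mem_univ i)]
    have hci : cov[W θ i, Z θ i; P] = 0 := by rw [hcov, hvar]; ring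
    rw [hci, zero_mul, zero_add]
    refine (Finset.abs_sum_le_sum_abs _ _).trans (Finset.sum_le_sum fun j hj => ?_)
    have hji := Finset.ne_of_mem_erase hj
    rw [abs_mul, hcov, abs_mul]
    have hsc : |sin θ * cos θ| ≤ 1 := by
      rw [abs_mul]
      exact mul_le_one₀ (abs_sin_le_one _) (abs_nonneg _) (abs_cos_le_one _)
    refine mul_le_mul (mul_le_of_le_one_left (abs_nonneg _) hsc) ?_ (abs_nonneg _) (abs_nonneg _)
    refine (abs_integral_le_integral_abs).trans (le_trans ?_ (hB i j hji.symm θ))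
    refine integral_mono_of_nonneg (ae_of_all _ fun _ => abs_nonneg _) ?_ (ae_of_all _ fun ω => ?_)
    · refine (integrable_const (C * C)).mono' (Measurable.aestronglyMeasurable (by fun_prop))
        (ae_of_all _ fun ω => ?_)
      simp only [norm_mul, norm_eq_abs, abs_abs]
      exact mul_le_mul (hφ' _ _) (hφ' _ _) (abs_nonneg _) (hC0 i)
    · simp only [if_neg hji, abs_mul]
      refine mul_le_mul_of_nonneg_right ?_ (abs_nonneg _)
      rw [← Finset.mul_prod_erase _ _ (Finset.mem_erase.2 ⟨hji.symm, Finset.mem_univ i⟩),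
        if_pos rfl, abs_mul]
      refine mul_le_of_le_one_right (abs_nonneg _) ?_
      rw [hφe _ (Finset.notMem_erase i _)]
      exact hprodb _ _
  have := (convex_univ (𝕜 := ℝ) (E := ℝ)).norm_image_sub_le_of_norm_hasDerivWithin_le
    (f := F) (C := ∑ i, ∑ j ∈ Finset.univ.erase i,
      |cov[U i, U j; P] - cov[V i, V j; P]| * B i j) (x := 0) (y := π / 2)
    (fun θ _ => (hder θ).hasDerivWithinAt)
    (fun θ _ => (Finset.abs_sum_le_sum_abs _ _).trans (Finset.sum_le_sum fun i _ => hDle i θ))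
    (Set.mem_univ _) (Set.mem_univ _)
  simpa [hF, hZ, abs_of_pos pi_pos] using this

lemma integral_gaussianPDFReal_gaussianReal (s : ℝ) {v τ : ℝ≥0} (hv : v ≠ 0) (hτ : τ ≠ 0) :
    ∫ x, gaussianPDFReal s τ x ∂(gaussianReal 0 v) = gaussianPDFReal 0 (v + τ) s := by
  rw [integral_gaussianReal_eq_integral_smul hv]
  have hv' : (0 : ℝ) < v := by exact_mod_cast pos_iff_ne_zero.2 hv
  have hτ' : (0 : ℝ) < τ := by exact_mod_cast pos_iff_ne_zero.2 hτ
  have key : ∀ x, gaussianPDFReal 0 v x • gaussianPDFReal s τ x =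
      gaussianPDFReal 0 (v + τ) s * gaussianPDFReal (s * v / (v + τ)) (v * τ / (v + τ)) x := by
    intro x
    simp only [gaussianPDFReal_def, smul_eq_mul, NNReal.coe_add, NNReal.coe_mul, NNReal.coe_div]
    rw [mul_mul_mul_comm, mul_mul_mul_comm (√(2 * π * (v + τ : ℝ)))⁻¹, ← exp_add, ← exp_add, ← mul_inv, ← mul_inv,
      ← sqrt_mul (by positivity), ← sqrt_mul (by positivity)]
    congr 2
    · congr 1
      field_simp
    · field_simp
      ring
  simp only [key]
  rw [integral_const_mul, integral_gaussianPDFReal_eq_one, mul_one]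
  have : v + τ ≠ 0 := by positivity
  positivity

lemma gaussianPDFReal_mul_gaussianPDFReal (a b x y : ℝ) {τ : ℝ≥0} (hτ : τ ≠ 0) :
    gaussianPDFReal a τ x * gaussianPDFReal b τ y =
      2 * (gaussianPDFReal (a + b) (2 * τ) (x + y) * gaussianPDFReal (a - b) (2 * τ) (x - y)) := by
  have hτ' : (0 : ℝ) < τ := by exact_mod_cast pos_iff_ne_zero.2 hτ
  simp only [gaussianPDFReal_def, NNReal.coe_mul, NNReal.coe_ofNat]
  rw [mul_mul_mul_comm, mul_mul_mul_comm (√(2 * π * (2 * τ : ℝ)))⁻¹, ← exp_add, ← exp_add,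
    ← mul_inv, ← mul_inv, mul_self_sqrt (by positivity), mul_self_sqrt (by positivity)]
  have h : -(x - a) ^ 2 / (2 * τ) + -(y - b) ^ 2 / (2 * τ) =
      -(x + y - (a + b)) ^ 2 / (2 * (2 * τ)) + -(x - y - (a - b)) ^ 2 / (2 * (2 * (τ : ℝ))) := by
    field_simp
    ring
  rw [h]
  field_simp

lemma integral_gaussianPDFReal_mul_le {Ω : Type*} [MeasurableSpace Ω] {P : Measure Ω}
    [IsProbabilityMeasure P] {Z₁ Z₂ : Ω → ℝ} (hG : HasGaussianLaw (fun ω => (Z₁ ω, Z₂ ω)) P)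
    (hZ₁ : ∫ ω, Z₁ ω ∂P = 0) (hZ₂ : ∫ ω, Z₂ ω ∂P = 0)
    (hv₁ : cov[Z₁, Z₁; P] = 1) (hv₂ : cov[Z₂, Z₂; P] = 1) {w : ℝ} (hw : w < 1)
    (hr : |cov[Z₁, Z₂; P]| ≤ w) {τ : ℝ≥0} (hτ : τ ≠ 0) {a b u : ℝ} (hu : 0 ≤ u) (ha : u ≤ a)
    (hb : u ≤ b) :
    ∫ ω, gaussianPDFReal a τ (Z₁ ω) * gaussianPDFReal b τ (Z₂ ω) ∂P ≤
      (2 * π * (1 - w))⁻¹ * exp (-u ^ 2 / (1 + w + τ)) := by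
  set r := cov[Z₁, Z₂; P] with hrdef
  have hr' := abs_le.1 hr
  have hL1 : MemLp Z₁ 2 P := hG.fst.memLp_two
  have hL2 : MemLp Z₂ 2 P := hG.snd.memLp_two
  have hτ' : (0 : ℝ) < τ := by exact_mod_cast pos_iff_ne_zero.2 hτ
  have hSD : HasGaussianLaw (fun ω => ((Z₁ + Z₂) ω, (Z₁ - Z₂) ω)) P := by
    let L : (ℝ × ℝ) →L[ℝ] (ℝ × ℝ) :=
      (ContinuousLinearMap.fst ℝ ℝ ℝ + ContinuousLinearMap.snd ℝ ℝ ℝ).prod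
        (ContinuousLinearMap.fst ℝ ℝ ℝ - ContinuousLinearMap.snd ℝ ℝ ℝ)
    exact hG.map_fun L
  have hind : (Z₁ + Z₂) ⟂ᵢ[P] (Z₁ - Z₂) := by
    refine hSD.indepFun_of_covariance_eq_zero ?_
    rw [covariance_add_left hL1 hL2 (hL1.sub hL2), covariance_sub_right hL1 hL1 hL2,
      covariance_sub_right hL2 hL1 hL2, covariance_comm Z₂ Z₁, hv₁, hv₂]
    ring
  have hVS : Var[Z₁ + Z₂; P] = 2 + 2 * r := by
    rw [← covariance_self hSD.fst.aemeasurable, covariance_add_left hL1 hL2 (hL1.add hL2),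
      covariance_add_right hL1 hL1 hL2,
      covariance_add_right hL2 hL1 hL2, covariance_comm Z₂ Z₁, hv₁, hv₂]
    ring
  have hVD : Var[Z₁ - Z₂; P] = 2 - 2 * r := by
    rw [← covariance_self hSD.snd.aemeasurable, covariance_sub_left hL1 hL2 (hL1.sub hL2),
      covariance_sub_right hL1 hL1 hL2,
      covariance_sub_right hL2 hL1 hL2, covariance_comm Z₂ Z₁, hv₁, hv₂]
    ring
  have hmS : P.map (Z₁ + Z₂) = gaussianReal 0 (2 + 2 * r).toNNReal := by
    have h0 : ∫ ω, (Z₁ + Z₂) ω ∂P = 0 := by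
      simp only [Pi.add_apply]
      rw [integral_add hG.fst.integrable hG.snd.integrable, hZ₁, hZ₂, add_zero]
    have := hSD.fst.map_eq_gaussianReal
    rw [← hVS]
    convert this using 2
    exact h0.symm
  have hmD : P.map (Z₁ - Z₂) = gaussianReal 0 (2 - 2 * r).toNNReal := by
    have h0 : ∫ ω, (Z₁ - Z₂) ω ∂P = 0 := by
      simp only [Pi.sub_apply]
      rw [integral_sub hG.fst.integrable hG.snd.integrable, hZ₁, hZ₂, sub_zero]
    have := hSD.snd.map_eq_gaussianReal
    rw [← hVD]
    convert this using 2
    exact h0.symm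
  have hprod := (hind.comp (measurable_gaussianPDFReal (a + b) (2 * τ))
    (measurable_gaussianPDFReal (a - b) (2 * τ))).integral_fun_mul_eq_mul_integral
    ((measurable_gaussianPDFReal _ _).comp_aemeasurable hSD.fst.aemeasurable).aestronglyMeasurable
    ((measurable_gaussianPDFReal _ _).comp_aemeasurable hSD.snd.aemeasurable).aestronglyMeasurable
  have h2τ : 2 * τ ≠ 0 := mul_ne_zero two_ne_zero hτ
  have hS : ∫ ω, (gaussianPDFReal (a + b) (2 * τ) ∘ (Z₁ + Z₂)) ω ∂P =
      gaussianPDFReal 0 ((2 + 2 * r).toNNReal + 2 * τ) (a + b) := by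
    rw [← integral_gaussianPDFReal_gaussianReal _ (by simp; linarith) h2τ, ← hmS,
      integral_map hSD.fst.aemeasurable
        (measurable_gaussianPDFReal _ _).aestronglyMeasurable]
    rfl
  have hD : ∫ ω, (gaussianPDFReal (a - b) (2 * τ) ∘ (Z₁ - Z₂)) ω ∂P =
      gaussianPDFReal 0 ((2 - 2 * r).toNNReal + 2 * τ) (a - b) := by
    rw [← integral_gaussianPDFReal_gaussianReal _ (by simp; linarith) h2τ, ← hmD,
      integral_map hSD.snd.aemeasurable
        (measurable_gaussianPDFReal _ _).aestronglyMeasurable]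
    rfl
  simp only [gaussianPDFReal_mul_gaussianPDFReal a b _ _ hτ]
  rw [integral_const_mul]
  simp only [Function.comp_apply, Pi.add_apply, Pi.sub_apply] at hprod hS hD
  rw [hprod, hS, hD]
  simp only [gaussianPDFReal_def, NNReal.coe_add, NNReal.coe_mul, NNReal.coe_ofNat, sub_zero]
  rw [Real.coe_toNNReal _ (by linarith), Real.coe_toNNReal _ (by linarith)]
  have hc1 : ∀ V : ℝ, 2 * (1 - w) ≤ V → (√(2 * π * V))⁻¹ ≤ (√(4 * π * (1 - w)))⁻¹ := by
    intro V hV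
    have : 0 < 1 - w := by linarith
    refine inv_anti₀ (by positivity) (sqrt_le_sqrt ?_)
    nlinarith [pi_pos]
  have hs : (√(4 * π * (1 - w)))⁻¹ * (√(4 * π * (1 - w)))⁻¹ = (4 * π * (1 - w))⁻¹ := by
    have : 0 ≤ 1 - w := by linarith
    rw [← mul_inv, mul_self_sqrt (by positivity)]
  have he1 : exp (-(a + b) ^ 2 / (2 * (2 + 2 * r + 2 * τ))) ≤ exp (-u ^ 2 / (1 + w + τ)) := by
    refine exp_le_exp.2 ?_
    rw [neg_div, neg_div, neg_le_neg_iff, div_le_div_iff₀ (by linarith) (by linarith)]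
    have h1 : (2 * u) ^ 2 ≤ (a + b) ^ 2 := pow_le_pow_left₀ (by linarith) (by linarith) 2
    nlinarith [sq_nonneg u, sq_nonneg (a + b)]
  have he2 : exp (-(a - b) ^ 2 / (2 * (2 - 2 * r + 2 * τ))) ≤ 1 := by
    rw [exp_le_one_iff, neg_div]
    have : 0 ≤ (a - b) ^ 2 / (2 * (2 - 2 * r + 2 * (τ : ℝ))) :=
      div_nonneg (sq_nonneg _) (by linarith)
    linarith
  calc _ ≤ 2 * ((√(4 * π * (1 - w)))⁻¹ * exp (-u ^ 2 / (1 + w + τ)) *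
        ((√(4 * π * (1 - w)))⁻¹ * 1)) := by
        refine mul_le_mul_of_nonneg_left ?_ zero_le_two
        refine mul_le_mul ?_ ?_ (by positivity) (by positivity)
        · exact mul_le_mul (hc1 _ (by linarith)) he1 (by positivity) (by positivity)
        · exact mul_le_mul (hc1 _ (by linarith)) he2 (by positivity) (by positivity)
    _ = 2 * ((√(4 * π * (1 - w)))⁻¹ * (√(4 * π * (1 - w)))⁻¹) * exp (-u ^ 2 / (1 + w + τ)) := by
        ring
    _ = _ := by
        have : 1 - w ≠ 0 := by linarith
        rw [hs]; field_simp; ring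

lemma hasDerivAt_cdf_gaussianReal (v : ℝ) :
    HasDerivAt (cdf (gaussianReal 0 1)) (gaussianPDFReal 0 1 v) v := by
  have hcont : Continuous (gaussianPDFReal 0 1) := by
    unfold gaussianPDFReal; fun_prop
  have hint := integrable_gaussianPDFReal 0 1
  have h : (cdf (gaussianReal 0 1) : ℝ → ℝ) =
      fun v => (∫ t in Set.Iic 0, gaussianPDFReal 0 1 t) + ∫ t in (0 : ℝ)..v, gaussianPDFReal 0 1 t := by
    ext v
    rw [← intervalIntegral.integral_Iic_sub_Iic hint.integrableOn hint.integrableOn,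
      add_sub_cancel, cdf_eq_real, measureReal_def, gaussianReal_apply_eq_integral _ one_ne_zero,
      ENNReal.toReal_ofReal]
    exact integral_nonneg fun _ => gaussianPDFReal_nonneg _ _ _
  rw [h]
  exact ((intervalIntegral.integral_hasDerivAt_right hint.intervalIntegrable
    (hcont.stronglyMeasurableAtFilter _ _) hcont.continuousAt).const_add _)

lemma gaussianPDFReal_le (c : ℝ) (τ : ℝ≥0) (v : ℝ) :
    gaussianPDFReal c τ v ≤ (√(2 * π * τ))⁻¹ := by
  rw [gaussianPDFReal_def]
  refine mul_le_of_le_one_right (by positivity) ?_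
  rw [exp_le_one_iff, neg_div]
  exact neg_nonpos.2 (by positivity)

lemma hasDerivAt_cdf_gaussianReal_comp (c v : ℝ) {N : ℝ} (hN : 0 < N) :
    HasDerivAt (fun v => cdf (gaussianReal 0 1) (N * (v - c)))
      (gaussianPDFReal c (N⁻¹ ^ 2).toNNReal v) v := by
  have h := (hasDerivAt_cdf_gaussianReal (N * (v - c))).comp v
    (((hasDerivAt_id v).sub_const c).const_mul N)
  refine h.congr_deriv ?_
  rw [gaussianPDFReal_def, gaussianPDFReal_def, Real.coe_toNNReal _ (by positivity),
    Real.sqrt_mul (by positivity) (N⁻¹ ^ 2), Real.sqrt_sq (by positivity)]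
  simp only [NNReal.coe_one, mul_one, sub_zero, mul_inv, inv_inv]
  have : -(N * (v - c)) ^ 2 / 2 = -(v - c) ^ 2 / (2 * N⁻¹ ^ 2) := by
    field_simp
  rw [this]; ring

lemma abs_integral_prod_step_sub_le {Ω ι κ : Type*} [MeasurableSpace Ω] {P : Measure Ω}
    [IsProbabilityMeasure P] [Fintype ι] [Fintype κ] {U V : ι → Ω → ℝ}
    (hG : HasGaussianLaw (fun ω => (fun i => U i ω, fun i => V i ω)) P)
    (hUm : ∀ i, Measurable (U i)) (hVm : ∀ i, Measurable (V i))
    (hU0 : ∀ i, ∫ ω, U i ω ∂P = 0) (hV0 : ∀ i, ∫ ω, V i ω ∂P = 0)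
    (hUV : ∀ i j, cov[U i, V j; P] = 0)
    (hU1 : ∀ i, cov[U i, U i; P] = 1) (hV1 : ∀ i, cov[V i, V i; P] = 1)
    {w : ι → ι → ℝ} (hw : ∀ i j, i ≠ j → w i j < 1)
    (hwU : ∀ i j, i ≠ j → |cov[U i, U j; P]| ≤ w i j)
    (hwV : ∀ i j, i ≠ j → |cov[V i, V j; P]| ≤ w i j)
    {α : ι → κ → ℝ} (hα : ∀ j k, 0 ≤ α j k) (hα1 : ∀ j, ∑ k, α j k ≤ 1)
    {c : κ → ℝ} {u : ℝ} (hu : 0 ≤ u) (hc : ∀ k, u ≤ c k) :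
    |∫ ω, ∏ j, (1 - ∑ k, α j k * (if c k < U j ω then 1 else 0)) ∂P -
      ∫ ω, ∏ j, (1 - ∑ k, α j k * (if c k < V j ω then 1 else 0)) ∂P| ≤
      (∑ i, ∑ j ∈ Finset.univ.erase i, |cov[U i, U j; P] - cov[V i, V j; P]| *
        ((2 * π * (1 - w i j))⁻¹ * exp (-u ^ 2 / (1 + w i j)))) * (π / 2) := by
  have hN : ∀ n : ℕ, (0 : ℝ) < n + 1 := fun n => by positivity
  set τ : ℕ → ℝ≥0 := fun n => (((n : ℝ) + 1)⁻¹ ^ 2).toNNReal with hτ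
  have hτ0 : ∀ n, τ n ≠ 0 := fun n => by
    simp only [hτ, ne_eq, Real.toNNReal_eq_zero, not_le]
    have := hN n
    positivity
  set φ : ℕ → ι → ℝ → ℝ := fun n j v =>
    1 - ∑ k, α j k * cdf (gaussianReal 0 1) ((n + 1) * (v - c k)) with hφdef
  set φ' : ℕ → ι → ℝ → ℝ := fun n j v =>
    - ∑ k, α j k * gaussianPDFReal (c k) (τ n) v with hφ'def
  have hd : ∀ n j v, HasDerivAt (φ n j) (φ' n j v) v := by
    intro n j v
    exact (HasDerivAt.fun_sum fun k _ =>
      (hasDerivAt_cdf_gaussianReal_comp (c k) v (hN n)).const_mul (α j k)).const_sub 1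
  have hφ01 : ∀ n j v, |φ n j v| ≤ 1 := by
    intro n j v
    have h0 : 0 ≤ ∑ k, α j k * cdf (gaussianReal 0 1) ((n + 1) * (v - c k)) :=
      Finset.sum_nonneg fun k _ => mul_nonneg (hα j k) (cdf_nonneg _ _)
    have h1 : ∑ k, α j k * cdf (gaussianReal 0 1) ((n + 1) * (v - c k)) ≤ 1 :=
      (Finset.sum_le_sum fun k _ => mul_le_of_le_one_right (hα j k) (cdf_le_one _ _)).trans (hα1 j)
    rw [abs_le]; constructor <;> simp only [hφdef] <;> linarith
  have habs : ∀ n j v, |φ' n j v| = ∑ k, α j k * gaussianPDFReal (c k) (τ n) v := by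
    intro n j v
    simp only [hφ'def]
    rw [abs_neg, abs_of_nonneg]
    exact Finset.sum_nonneg fun k _ => mul_nonneg (hα j k) (gaussianPDFReal_nonneg _ _ _)
  have hφ'C : ∀ n j v, |φ' n j v| ≤ (√(2 * π * τ n))⁻¹ := by
    intro n j v
    rw [habs]
    calc _ ≤ ∑ k, α j k * (√(2 * π * τ n))⁻¹ := Finset.sum_le_sum fun k _ =>
          mul_le_mul_of_nonneg_left (gaussianPDFReal_le _ _ _) (hα j k)
      _ = (∑ k, α j k) * (√(2 * π * τ n))⁻¹ := by rw [Finset.sum_mul]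
      _ ≤ _ := mul_le_of_le_one_left (by positivity) (hα1 j)
  have hφ'm : ∀ n j, Measurable (φ' n j) := fun n j =>
    (Finset.measurable_fun_sum _ fun k _ =>
      (measurable_gaussianPDFReal (c k) (τ n)).const_mul (α j k)).neg
  have hφm : ∀ n j, Measurable (φ n j) := fun n j =>
    (continuous_iff_continuousAt.2 fun v => (hd n j v).continuousAt).measurable
  have hbound : ∀ n, |∫ ω, ∏ j, φ n j (U j ω) ∂P - ∫ ω, ∏ j, φ n j (V j ω) ∂P| ≤
      (∑ i, ∑ j ∈ Finset.univ.erase i, |cov[U i, U j; P] - cov[V i, V j; P]| *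
        ((2 * π * (1 - w i j))⁻¹ * exp (-u ^ 2 / (1 + w i j + τ n)))) * (π / 2) := by
    intro n
    refine abs_integral_prod_sub_integral_prod_le hG hUm hVm hU0 hV0 hUV
      (fun i => (hU1 i).trans (hV1 i).symm) (hφ'm n) (hφ01 n) (hφ'C n) (hd n) ?_
    intro i j hij θ
    have hUL : ∀ i, MemLp (U i) 2 P := fun i => (hG.fst.eval i).memLp_two
    have hVL : ∀ i, MemLp (V i) 2 P := fun i => (hG.snd.eval i).memLp_two
    set Z : ι → Ω → ℝ := fun i ω => sin θ * U i ω + cos θ * V i ω with hZ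
    have hZpair : HasGaussianLaw (fun ω => (Z i ω, Z j ω)) P := by
      let L : (ι → ℝ) × (ι → ℝ) →L[ℝ] ℝ × ℝ :=
        (sin θ • (ContinuousLinearMap.proj i).comp (ContinuousLinearMap.fst ℝ (ι → ℝ) (ι → ℝ)) +
          cos θ • (ContinuousLinearMap.proj i).comp (ContinuousLinearMap.snd ℝ _ _)).prod
        (sin θ • (ContinuousLinearMap.proj j).comp (ContinuousLinearMap.fst ℝ (ι → ℝ) (ι → ℝ)) +
          cos θ • (ContinuousLinearMap.proj j).comp (ContinuousLinearMap.snd ℝ _ _))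
      exact hG.map_fun L
    have hZ0 : ∀ i, ∫ ω, Z i ω ∂P = 0 := by
      intro i
      simp only [hZ]
      rw [integral_add (((hUL i).integrable (by norm_num)).const_mul _)
        (((hVL i).integrable (by norm_num)).const_mul _), integral_const_mul, integral_const_mul,
        hU0, hV0]
      simp
    have hZcov : ∀ i j, cov[Z i, Z j; P] =
        sin θ ^ 2 * cov[U i, U j; P] + cos θ ^ 2 * cov[V i, V j; P] := by
      intro i j
      have e : ∀ i, Z i = (fun ω => sin θ * U i ω) + fun ω => cos θ * V i ω := fun i => rfl
      have hU' := fun i => (hUL i).const_mul (sin θ)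
      have hV' := fun i => (hVL i).const_mul (cos θ)
      rw [e, e, covariance_add_left (hU' i) (hV' i) ((hU' j).add (hV' j)),
        covariance_add_right (hU' i) (hU' j) (hV' j),
        covariance_add_right (hV' i) (hU' j) (hV' j)]
      simp only [covariance_const_mul_left, covariance_const_mul_right]
      rw [hUV, covariance_comm (V i) (U j), hUV]
      ring
    have hsc := sin_sq_add_cos_sq θ
    have hZ1 : ∀ i, cov[Z i, Z i; P] = 1 := fun i => by
      rw [hZcov, hU1, hV1]; linarith
    have hZw : |cov[Z i, Z j; P]| ≤ w i j := by
      rw [hZcov]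
      calc _ ≤ |sin θ ^ 2 * cov[U i, U j; P]| + |cos θ ^ 2 * cov[V i, V j; P]| := abs_add_le _ _
        _ = sin θ ^ 2 * |cov[U i, U j; P]| + cos θ ^ 2 * |cov[V i, V j; P]| := by
          rw [abs_mul, abs_mul, abs_of_nonneg (sq_nonneg (sin θ)),
            abs_of_nonneg (sq_nonneg (cos θ))]
        _ ≤ sin θ ^ 2 * w i j + cos θ ^ 2 * w i j :=
          add_le_add (mul_le_mul_of_nonneg_left (hwU i j hij) (sq_nonneg _))
            (mul_le_mul_of_nonneg_left (hwV i j hij) (sq_nonneg _))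
        _ = w i j := by rw [← add_mul, hsc, one_mul]
    have hZm : ∀ i, Measurable (Z i) := fun i => by simp only [hZ]; fun_prop
    have hint : ∀ k l, Integrable (fun ω => α i k * α j l *
        (gaussianPDFReal (c k) (τ n) (Z i ω) * gaussianPDFReal (c l) (τ n) (Z j ω))) P := by
      intro k l
      refine Integrable.const_mul ?_ _
      refine Integrable.of_bound (((measurable_gaussianPDFReal _ _).comp (hZm i)).mul
        ((measurable_gaussianPDFReal _ _).comp (hZm j))).aestronglyMeasurable
        ((√(2 * π * τ n))⁻¹ * (√(2 * π * τ n))⁻¹) (ae_of_all _ fun ω => ?_)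
      rw [norm_mul, Real.norm_of_nonneg (gaussianPDFReal_nonneg _ _ _),
        Real.norm_of_nonneg (gaussianPDFReal_nonneg _ _ _)]
      exact mul_le_mul (gaussianPDFReal_le _ _ _) (gaussianPDFReal_le _ _ _)
        (gaussianPDFReal_nonneg _ _ _) (by positivity)
    have hw' : 0 < 1 - w i j := by linarith [hw i j hij]
    calc _ = ∫ ω, ∑ k, ∑ l, α i k * α j l *
        (gaussianPDFReal (c k) (τ n) (Z i ω) * gaussianPDFReal (c l) (τ n) (Z j ω)) ∂P := by
          congr 1; ext ω
          rw [habs, habs, Finset.sum_mul_sum]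
          refine Finset.sum_congr rfl fun k _ => Finset.sum_congr rfl fun l _ => ?_
          rw [mul_mul_mul_comm]
      _ = ∑ k, ∑ l, α i k * α j l * ∫ ω,
        gaussianPDFReal (c k) (τ n) (Z i ω) * gaussianPDFReal (c l) (τ n) (Z j ω) ∂P := by
          rw [integral_finsetSum _ fun k _ => integrable_finsetSum _ fun l _ => hint k l]
          refine Finset.sum_congr rfl fun k _ => ?_
          rw [integral_finsetSum _ fun l _ => hint k l]
          refine Finset.sum_congr rfl fun l _ => ?_
          rw [integral_const_mul]
      _ ≤ ∑ k, ∑ l, α i k * α j l *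
          ((2 * π * (1 - w i j))⁻¹ * exp (-u ^ 2 / (1 + w i j + τ n))) := by
          refine Finset.sum_le_sum fun k _ => Finset.sum_le_sum fun l _ => ?_
          exact mul_le_mul_of_nonneg_left
            (integral_gaussianPDFReal_mul_le hZpair (hZ0 i) (hZ0 j) (hZ1 i) (hZ1 j) (hw i j hij)
              hZw (hτ0 n) hu (hc k) (hc l)) (mul_nonneg (hα i k) (hα j l))
      _ = (∑ k, α i k) * (∑ l, α j l) *
          ((2 * π * (1 - w i j))⁻¹ * exp (-u ^ 2 / (1 + w i j + τ n))) := by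
          rw [Finset.sum_mul_sum, Finset.sum_mul]
          refine Finset.sum_congr rfl fun k _ => ?_
          rw [Finset.sum_mul]
      _ ≤ _ := mul_le_of_le_one_left (by positivity)
          (mul_le_one₀ (hα1 i) (Finset.sum_nonneg fun k _ => hα j k) (hα1 j))
  have hlim : ∀ Z : ι → Ω → ℝ, (∀ i, Measurable (Z i)) → (∀ i, P.map (Z i) = gaussianReal 0 1) →
      Tendsto (fun n => ∫ ω, ∏ j, φ n j (Z j ω) ∂P) atTop
        (nhds (∫ ω, ∏ j, (1 - ∑ k, α j k * (if c k < Z j ω then 1 else 0)) ∂P)) := by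
    intro Z hZ hZl
    refine tendsto_integral_of_dominated_convergence (fun _ => 1) ?_ (integrable_const _) ?_ ?_
    · intro n
      exact (Finset.measurable_fun_prod _ fun j _ => (hφm n j).comp (hZ j)).aestronglyMeasurable
    · intro n
      refine ae_of_all _ fun ω => ?_
      rw [Real.norm_eq_abs, Finset.abs_prod]
      exact Finset.prod_le_one (fun _ _ => abs_nonneg _) fun j _ => hφ01 n j _
    · have hne : ∀ᵐ ω ∂P, ∀ j k, Z j ω ≠ c k := by
        rw [ae_all_iff]; intro j
        rw [ae_all_iff]; intro k
        have : P.map (Z j) {c k} = 0 := by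
          rw [hZl]
          have := nullSingletonClass_gaussianReal (μ := 0) (v := 1) one_ne_zero
          exact measure_singleton _
        rw [Measure.map_apply (hZ j) (measurableSet_singleton _)] at this
        exact measure_eq_zero_iff_ae_notMem.1 this
      filter_upwards [hne] with ω hω
      refine tendsto_finsetProd _ fun j _ => ?_
      refine Tendsto.const_sub _ (tendsto_finsetSum _ fun k _ => Tendsto.const_mul _ ?_)
      have hinf : Tendsto (fun n : ℕ => (n : ℝ) + 1) atTop atTop :=
        tendsto_atTop_add_const_right _ _ tendsto_natCast_atTop_atTop
      rcases lt_or_gt_of_ne (hω j k) with h | h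
      · rw [if_neg h.not_gt]
        exact (tendsto_cdf_atBot _).comp (hinf.atTop_mul_const_of_neg (by linarith))
      · rw [if_pos h]
        exact (tendsto_cdf_atTop _).comp (hinf.atTop_mul_const (by linarith))
  have hlaw : ∀ Z : Ω → ℝ, HasGaussianLaw Z P → ∫ ω, Z ω ∂P = 0 → cov[Z, Z; P] = 1 →
      P.map Z = gaussianReal 0 1 := by
    intro Z hZ h0 h1
    rw [hZ.map_eq_gaussianReal, h0, ← covariance_self hZ.aemeasurable, h1, Real.toNNReal_one]
  refine le_of_tendsto_of_tendsto
    (((hlim U hUm fun i => hlaw _ (hG.fst.eval i) (hU0 i) (hU1 i)).sub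
      (hlim V hVm fun i => hlaw _ (hG.snd.eval i) (hV0 i) (hV1 i))).abs) ?_
    (Eventually.of_forall hbound)
  have hτlim : Tendsto (fun n => (τ n : ℝ)) atTop (nhds 0) := by
    have h := (tendsto_one_div_add_atTop_nhds_zero_nat (𝕜 := ℝ)).pow 2
    rw [zero_pow two_ne_zero] at h
    refine h.congr fun n => ?_
    rw [hτ, Real.coe_toNNReal _ (by positivity), one_div]
  refine Tendsto.mul_const _ (tendsto_finsetSum _ fun i _ => tendsto_finsetSum _ fun j hj =>
    Tendsto.const_mul _ (Tendsto.const_mul _ ?_))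
  have hij : i ≠ j := (Finset.ne_of_mem_erase hj).symm
  have hw0 : 0 ≤ w i j := (abs_nonneg _).trans (hwU i j hij)
  have : Tendsto (fun n => -u ^ 2 / (1 + w i j + τ n)) atTop (nhds (-u ^ 2 / (1 + w i j + 0))) :=
    Tendsto.div tendsto_const_nhds (tendsto_const_nhds.add hτlim) (by linarith)
  rw [add_zero] at this
  exact (continuous_exp.tendsto _).comp this

lemma covariance_comp_of_measurePreserving {α β : Type*} [MeasurableSpace α] [MeasurableSpace β]
    {μ : Measure α} {ν : Measure β} {h : α → β} (hh : MeasurePreserving h μ ν) (X Y : β → ℝ)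
    (hX : Measurable X) (hY : Measurable Y) :
    cov[fun ω => X (h ω), fun ω => Y (h ω); μ] = cov[X, Y; ν] := by
  rw [← hh.map_eq, covariance_map_fun hX.aestronglyMeasurable hY.aestronglyMeasurable
    hh.measurable.aemeasurable]

lemma covariance_eval_pi_gaussianReal {ι : Type*} [Fintype ι] (i j : ι) :
    cov[fun t : ι → ℝ => t i, fun t => t j; Measure.pi fun _ : ι => gaussianReal 0 1] =
      if i = j then 1 else 0 := by
  have hm : ∀ i : ι, MemLp (fun t : ι → ℝ => t i) 2 (Measure.pi fun _ : ι => gaussianReal 0 1) :=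
    fun i => (memLp_id_gaussianReal 2).comp_measurePreserving (measurePreserving_eval _ i)
  split_ifs with h
  · subst h
    refine (covariance_comp_of_measurePreserving (measurePreserving_eval
      (fun _ : ι => gaussianReal 0 1) i) id id measurable_id measurable_id).trans ?_
    rw [covariance_self measurable_id.aemeasurable, variance_id_gaussianReal]
    simp
  · exact ((iIndepFun_pi (X := fun _ : ι => (id : ℝ → ℝ))
      fun _ => aemeasurable_id).indepFun h).covariance_eq_zero (hm i) (hm j)

section mixture

variable {ι : Type*} [Fintype ι]

lemma hasGaussianLaw_mixture (ρ : ℝ) :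
    HasGaussianLaw (fun q : ℝ × (ι → ℝ) => fun i => √(1 - ρ) * q.2 i + √ρ * q.1)
      ((gaussianReal 0 1).prod (Measure.pi fun _ : ι => gaussianReal 0 1)) := by
  have h1 : HasGaussianLaw (fun t : ι → ℝ => fun i => t i)
      (Measure.pi fun _ : ι => gaussianReal 0 1) :=
    iIndepFun.hasGaussianLaw (X := fun i (t : ι → ℝ) => t i)
      (fun i => ⟨by rw [(measurePreserving_eval _ i).map_eq]; infer_instance⟩)
      (iIndepFun_pi (X := fun _ : ι => (id : ℝ → ℝ)) fun _ => aemeasurable_id)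
  have h2 : HasGaussianLaw (fun q : ℝ × (ι → ℝ) => (q.1, q.2))
      ((gaussianReal 0 1).prod (Measure.pi fun _ : ι => gaussianReal 0 1)) := by
    refine IndepFun.hasGaussianLaw ⟨?_⟩ ⟨?_⟩ (indepFun_prod measurable_id measurable_id)
    · rw [measurePreserving_fst.map_eq]; infer_instance
    · rw [measurePreserving_snd.map_eq]
      have := h1.isGaussian_map
      rwa [Measure.map_id'] at this
  let L : ℝ × (ι → ℝ) →L[ℝ] (ι → ℝ) := ContinuousLinearMap.pi fun i =>
    √(1 - ρ) • (ContinuousLinearMap.proj i).comp (ContinuousLinearMap.snd ℝ ℝ (ι → ℝ)) +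
      √ρ • ContinuousLinearMap.fst ℝ ℝ (ι → ℝ)
  exact h2.map_fun L

lemma integral_mixture (ρ : ℝ) (i : ι) : ∫ q : ℝ × (ι → ℝ), (√(1 - ρ) * q.2 i + √ρ * q.1)
    ∂((gaussianReal 0 1).prod (Measure.pi fun _ : ι => gaussianReal 0 1)) = 0 := by
  have hid : Integrable (fun t : ℝ => t) (gaussianReal 0 1) :=
    (memLp_id_gaussianReal 1).integrable le_rfl
  have hp : MeasurePreserving (fun q : ℝ × (ι → ℝ) => q.2 i)
      ((gaussianReal 0 1).prod (Measure.pi fun _ : ι => gaussianReal 0 1)) (gaussianReal 0 1) :=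
    (measurePreserving_eval _ i).comp measurePreserving_snd
  have hq : MeasurePreserving (fun q : ℝ × (ι → ℝ) => q.1)
      ((gaussianReal 0 1).prod (Measure.pi fun _ : ι => gaussianReal 0 1)) (gaussianReal 0 1) :=
    measurePreserving_fst
  have i1 : Integrable (fun q : ℝ × (ι → ℝ) => q.2 i) _ := hp.integrable_comp_of_integrable hid
  have i2 : Integrable (fun q : ℝ × (ι → ℝ) => q.1) _ := hq.integrable_comp_of_integrable hid
  rw [integral_add (i1.const_mul _) (i2.const_mul _), integral_const_mul, integral_const_mul]
  have e1 := integral_map (μ := (gaussianReal 0 1).prod (Measure.pi fun _ : ι => gaussianReal 0 1))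
    hp.measurable.aemeasurable (f := fun t : ℝ => t) measurable_id.aestronglyMeasurable
  have e2 := integral_map (μ := (gaussianReal 0 1).prod (Measure.pi fun _ : ι => gaussianReal 0 1))
    hq.measurable.aemeasurable (f := fun t : ℝ => t) measurable_id.aestronglyMeasurable
  rw [← e1, ← e2, hp.map_eq, hq.map_eq, integral_id_gaussianReal]
  simp

lemma covariance_mixture {ρ : ℝ} (h0 : 0 ≤ ρ) (h1 : ρ ≤ 1) (i j : ι) :
    cov[fun q : ℝ × (ι → ℝ) => √(1 - ρ) * q.2 i + √ρ * q.1,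
      fun q : ℝ × (ι → ℝ) => √(1 - ρ) * q.2 j + √ρ * q.1;
      (gaussianReal 0 1).prod (Measure.pi fun _ : ι => gaussianReal 0 1)] =
      if i = j then 1 else ρ := by
  set R := (gaussianReal 0 1).prod (Measure.pi fun _ : ι => gaussianReal 0 1) with hR
  have hp : ∀ i, MemLp (fun q : ℝ × (ι → ℝ) => q.2 i) 2 R := fun i =>
    (memLp_id_gaussianReal 2).comp_measurePreserving
      ((measurePreserving_eval (fun _ : ι => gaussianReal 0 1) i).comp measurePreserving_snd)
  have hq : MemLp (fun q : ℝ × (ι → ℝ) => q.1) 2 R :=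
    (memLp_id_gaussianReal 2).comp_measurePreserving measurePreserving_fst
  have hz : ∀ i, cov[fun q : ℝ × (ι → ℝ) => q.2 i, fun q => q.1; R] = 0 := fun i =>
    (indepFun_prod (μ := gaussianReal 0 1) (ν := Measure.pi fun _ : ι => gaussianReal 0 1)
      (X := id) (Y := fun t : ι → ℝ => t i) measurable_id
      (measurable_pi_apply i)).symm.covariance_eq_zero (hp i) hq
  have hpp : cov[fun q : ℝ × (ι → ℝ) => q.2 i, fun q => q.2 j; R] = if i = j then 1 else 0 := by
    rw [← covariance_eval_pi_gaussianReal i j]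
    exact covariance_comp_of_measurePreserving measurePreserving_snd (fun t : ι → ℝ => t i)
      (fun t => t j) (measurable_pi_apply i) (measurable_pi_apply j)
  have hqq : cov[fun q : ℝ × (ι → ℝ) => q.1, fun q => q.1; R] = 1 := by
    refine (covariance_comp_of_measurePreserving measurePreserving_fst id id
      measurable_id measurable_id).trans ?_
    rw [covariance_self measurable_id.aemeasurable, variance_id_gaussianReal]
    simp
  have a1 := fun i => (hp i).const_mul √(1 - ρ)
  have a2 := hq.const_mul √ρ
  have := covariance_add_left (a1 i) a2 ((a1 j).add a2)
  rw [covariance_add_right (a1 i) (a1 j) a2, covariance_add_right a2 (a1 j) a2] at this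
  simp only [covariance_const_mul_left, covariance_const_mul_right] at this
  rw [covariance_comm (fun q : ℝ × (ι → ℝ) => q.1), hz, hz, hpp, hqq] at this
  refine this.trans ?_
  have e1 := mul_self_sqrt h0
  have e2 := mul_self_sqrt (sub_nonneg.2 h1)
  split_ifs
  · linear_combination e1 + e2
  · linear_combination e1

end mixture

lemma abs_integral_prod_step_sub_mixture_le {Ω ι κ : Type*} [MeasurableSpace Ω] {P : Measure Ω}
    [IsProbabilityMeasure P] [Fintype ι] [Fintype κ] {U : ι → Ω → ℝ}
    (hG : HasGaussianLaw (fun ω => fun i => U i ω) P)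
    (hUm : ∀ i, Measurable (U i)) (hU0 : ∀ i, ∫ ω, U i ω ∂P = 0)
    (hU1 : ∀ i, cov[U i, U i; P] = 1) {ρ : ℝ} (hρ0 : 0 ≤ ρ) (hρ1 : ρ ≤ 1)
    {w : ι → ι → ℝ} (hw : ∀ i j, i ≠ j → w i j < 1)
    (hwU : ∀ i j, i ≠ j → |cov[U i, U j; P]| ≤ w i j) (hwρ : ∀ i j, i ≠ j → ρ ≤ w i j)
    {α : ι → κ → ℝ} (hα : ∀ j k, 0 ≤ α j k) (hα1 : ∀ j, ∑ k, α j k ≤ 1)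
    {c : κ → ℝ} {u : ℝ} (hu : 0 ≤ u) (hc : ∀ k, u ≤ c k) :
    |∫ ω, ∏ j, (1 - ∑ k, α j k * (if c k < U j ω then 1 else 0)) ∂P -
      ∫ z, ∏ j, (1 - ∑ k, α j k * (gaussianReal 0 1).real {t | c k < √(1 - ρ) * t + √ρ * z})
        ∂(gaussianReal 0 1)| ≤
      (∑ i, ∑ j ∈ Finset.univ.erase i, |cov[U i, U j; P] - ρ| *
        ((2 * π * (1 - w i j))⁻¹ * exp (-u ^ 2 / (1 + w i j)))) * (π / 2) := by
  set Q := Measure.pi fun _ : ι => gaussianReal 0 1 with hQ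
  set R := (gaussianReal 0 1).prod Q with hR
  set V₀ : ι → ℝ × (ι → ℝ) → ℝ := fun i q => √(1 - ρ) * q.2 i + √ρ * q.1 with hV₀
  have hV₀m : ∀ i, Measurable (V₀ i) := fun i => by simp only [hV₀]; fun_prop
  have hfst : MeasurePreserving Prod.fst (P.prod R) P := measurePreserving_fst
  have hsnd : MeasurePreserving Prod.snd (P.prod R) R := measurePreserving_snd
  have hUpi : Measurable (fun ω i => U i ω) := measurable_pi_lambda _ hUm
  have hVpi : Measurable (fun q i => V₀ i q) := measurable_pi_lambda _ hV₀m
  have hGU : HasGaussianLaw (fun (q : Ω × (ℝ × (ι → ℝ))) i => U i q.1) (P.prod R) := by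
    refine ⟨?_⟩
    have := Measure.map_map (μ := P.prod R) hUpi hfst.measurable
    rw [hfst.map_eq] at this
    exact this ▸ hG.isGaussian_map
  have hGV : HasGaussianLaw (fun (q : Ω × (ℝ × (ι → ℝ))) i => V₀ i q.2) (P.prod R) := by
    refine ⟨?_⟩
    have := Measure.map_map (μ := P.prod R) hVpi hsnd.measurable
    rw [hsnd.map_eq] at this
    exact this ▸ (hasGaussianLaw_mixture ρ).isGaussian_map
  have hind := indepFun_prod (μ := P) (ν := R) hUpi hVpi
  have hGG := hind.hasGaussianLaw hGU hGV
  have hcovU : ∀ i j, cov[fun q : Ω × (ℝ × (ι → ℝ)) => U i q.1, fun q => U j q.1; P.prod R] =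
      cov[U i, U j; P] := fun i j =>
    covariance_comp_of_measurePreserving hfst _ _ (hUm i) (hUm j)
  have hcovV : ∀ i j, cov[fun q : Ω × (ℝ × (ι → ℝ)) => V₀ i q.2, fun q => V₀ j q.2; P.prod R] =
      if i = j then 1 else ρ := fun i j =>
    (covariance_comp_of_measurePreserving hsnd _ _ (hV₀m i) (hV₀m j)).trans
      (covariance_mixture hρ0 hρ1 i j)
  have hmain := abs_integral_prod_step_sub_le (P := P.prod R)
    (U := fun i q => U i q.1) (V := fun i q => V₀ i q.2) hGG
    (fun i => (hUm i).comp measurable_fst) (fun i => (hV₀m i).comp measurable_snd)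
    (fun i => by rw [integral_fun_fst (U i)]; simp [hU0])
    (fun i => by rw [integral_fun_snd (V₀ i)]; simp [hV₀, hR, hQ, integral_mixture ρ i])
    (fun i j => (indepFun_prod (hUm i) (hV₀m j)).covariance_eq_zero (hGU.eval i).memLp_two
      (hGV.eval j).memLp_two)
    (fun i => by rw [hcovU, hU1]) (fun i => by rw [hcovV, if_pos rfl]) hw
    (fun i j hij => by rw [hcovU]; exact hwU i j hij)
    (fun i j hij => by rw [hcovV, if_neg hij, abs_of_nonneg hρ0]; exact hwρ i j hij)
    hα hα1 hu hc
  have hstep01 : ∀ j (v : ℝ), |1 - ∑ k, α j k * (if c k < v then 1 else 0)| ≤ 1 := by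
    intro j v
    have h0 : 0 ≤ ∑ k, α j k * (if c k < v then (1 : ℝ) else 0) :=
      Finset.sum_nonneg fun k _ => mul_nonneg (hα j k) (by split_ifs <;> norm_num)
    have h1 : ∑ k, α j k * (if c k < v then (1 : ℝ) else 0) ≤ 1 :=
      (Finset.sum_le_sum fun k _ => mul_le_of_le_one_right (hα j k)
        (by split_ifs <;> norm_num)).trans (hα1 j)
    rw [abs_le]; constructor <;> linarith
  have hstepm : ∀ j, Measurable fun v : ℝ => 1 - ∑ k, α j k * (if c k < v then (1 : ℝ) else 0) :=
    fun j => (Finset.measurable_fun_sum _ fun k _ => (Measurable.ite measurableSet_Ioi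
      measurable_const measurable_const).const_mul _).const_sub 1
  have e1 : ∫ q : Ω × (ℝ × (ι → ℝ)), ∏ j, (1 - ∑ k, α j k * (if c k < U j q.1 then 1 else 0))
      ∂(P.prod R) = ∫ ω, ∏ j, (1 - ∑ k, α j k * (if c k < U j ω then 1 else 0)) ∂P := by
    rw [integral_fun_fst fun ω => ∏ j, (1 - ∑ k, α j k * (if c k < U j ω then (1 : ℝ) else 0))]
    simp
  have e2 : ∫ q : Ω × (ℝ × (ι → ℝ)), ∏ j, (1 - ∑ k, α j k * (if c k < V₀ j q.2 then 1 else 0))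
      ∂(P.prod R) = ∫ z, ∏ j, (1 - ∑ k, α j k *
        (gaussianReal 0 1).real {t | c k < √(1 - ρ) * t + √ρ * z}) ∂(gaussianReal 0 1) := by
    rw [integral_fun_snd fun q => ∏ j, (1 - ∑ k, α j k * (if c k < V₀ j q then (1 : ℝ) else 0))]
    simp only [probReal_univ, one_smul]
    rw [hR, integral_prod]
    · congr 1
      ext z
      simp only [hV₀]
      rw [hQ, integral_fintype_prod_eq_prod (𝕜 := ℝ) fun j (t : ℝ) =>
        1 - ∑ k, α j k * (if c k < √(1 - ρ) * t + √ρ * z then 1 else 0)]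
      refine Finset.prod_congr rfl fun j _ => ?_
      have hms : ∀ k, MeasurableSet {t : ℝ | c k < √(1 - ρ) * t + √ρ * z} := fun k =>
        measurableSet_lt measurable_const (by fun_prop)
      have hi : ∀ k, Integrable (fun t : ℝ => if c k < √(1 - ρ) * t + √ρ * z then (1 : ℝ) else 0)
          (gaussianReal 0 1) := fun k =>
        Integrable.of_bound (Measurable.ite (hms k) measurable_const
          measurable_const).aestronglyMeasurable 1 (ae_of_all _ fun t => by split_ifs <;> simp)
      rw [integral_sub (integrable_const _) (integrable_finsetSum _ fun k _ => (hi k).const_mul _),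
        integral_finsetSum _ fun k _ => (hi k).const_mul _]
      simp only [integral_const, probReal_univ, one_smul, integral_const_mul]
      congr 1
      refine Finset.sum_congr rfl fun k _ => ?_
      congr 1
      exact integral_indicator_one (hms k)
    · refine Integrable.of_bound (Finset.measurable_fun_prod _ fun j _ =>
        (hstepm j).comp (hV₀m j)).aestronglyMeasurable 1 (ae_of_all _ fun q => ?_)
      rw [Real.norm_eq_abs, Finset.abs_prod]
      exact Finset.prod_le_one (fun _ _ => abs_nonneg _) fun j _ => hstep01 j _
  rw [e1, e2] at hmain
  refine hmain.trans (le_of_eq ?_)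
  congr 1
  refine Finset.sum_congr rfl fun i _ => Finset.sum_congr rfl fun j hj => ?_
  rw [hcovU, hcovV, if_neg (Finset.ne_of_mem_erase hj).symm]

lemma integral_mul_eq_of_stationary {Ω : Type*} [MeasurableSpace Ω] {P : Measure Ω}
    {X : ℕ → Ω → ℝ} (hXmeas : ∀ n, Measurable (X n))
    (hstat : ∀ (m k : ℕ), Measure.map (fun ω => fun i : Fin m => X (i.1 + 1 + k) ω) P =
      Measure.map (fun ω => fun i : Fin m => X (i.1 + 1) ω) P) (d k : ℕ) :
    ∫ ω, X (k + 1) ω * X (k + 1 + d) ω ∂P = ∫ ω, X 1 ω * X (d + 1) ω ∂P := by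
  have h := congrArg (fun μ => ∫ v, v 0 * v (Fin.last d) ∂μ) (hstat (d + 1) k)
  have hm : Measurable fun v : Fin (d + 1) → ℝ => v 0 * v (Fin.last d) :=
    (measurable_pi_apply _).mul (measurable_pi_apply _)
  rw [integral_map (measurable_pi_lambda _ fun i => hXmeas _).aemeasurable
      hm.aestronglyMeasurable,
    integral_map (measurable_pi_lambda _ fun i => hXmeas _).aemeasurable
      hm.aestronglyMeasurable] at h
  simpa [add_comm, add_left_comm] using h

lemma memLp_two_of_map_eq_gaussianReal {Ω : Type*} [MeasurableSpace Ω] {P : Measure Ω} {Z : Ω → ℝ}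
    (hZ : Measurable Z) (h : P.map Z = gaussianReal 0 1) : MemLp Z 2 P := by
  have := memLp_id_gaussianReal (μ := 0) (v := 1) 2
  rw [← h] at this
  exact (memLp_map_measure_iff measurable_id.aestronglyMeasurable hZ.aemeasurable).1 this

lemma integral_eq_zero_of_map_eq_gaussianReal {Ω : Type*} [MeasurableSpace Ω] {P : Measure Ω}
    {Z : Ω → ℝ} (hZ : Measurable Z) (h : P.map Z = gaussianReal 0 1) : ∫ ω, Z ω ∂P = 0 := by
  have := integral_map hZ.aemeasurable (μ := P) (f := fun t : ℝ => t)
    measurable_id.aestronglyMeasurable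
  rw [← this, h, integral_id_gaussianReal]

lemma integral_mul_self_of_map_eq_gaussianReal {Ω : Type*} [MeasurableSpace Ω] {P : Measure Ω}
    {Z : Ω → ℝ} (hZ : Measurable Z) (h' : P.map Z = gaussianReal 0 1) :
    ∫ ω, Z ω * Z ω ∂P = 1 := by
  have h := variance_id_gaussianReal (μ := 0) (v := 1)
  rw [variance_eq_integral measurable_id.aemeasurable] at h
  simp only [id_eq, integral_id_gaussianReal, sub_zero] at h
  rw [← h', integral_map hZ.aemeasurable (by fun_prop)] at h
  simpa [sq] using h

lemma covariance_of_map_eq_gaussianReal {Ω : Type*} [MeasurableSpace Ω] {P : Measure Ω}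
    [IsProbabilityMeasure P] {Y Z : Ω → ℝ} (hY : Measurable Y) (hZ : Measurable Z)
    (h : P.map Y = gaussianReal 0 1) (h' : P.map Z = gaussianReal 0 1) :
    cov[Y, Z; P] = ∫ ω, Y ω * Z ω ∂P := by
  rw [covariance_eq_sub (memLp_two_of_map_eq_gaussianReal hY h)
    (memLp_two_of_map_eq_gaussianReal hZ h'), integral_eq_zero_of_map_eq_gaussianReal hY h]
  simp

lemma ae_eq_of_integral_mul_eq {Ω : Type*} [MeasurableSpace Ω] {P : Measure Ω}
    [IsProbabilityMeasure P] {Y Z : Ω → ℝ} (hY : Measurable Y) (hZ : Measurable Z)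
    (h : P.map Y = gaussianReal 0 1) (h' : P.map Z = gaussianReal 0 1) {s : ℝ} (hs : s ^ 2 = 1)
    (hYZ : ∫ ω, Y ω * Z ω ∂P = s) : Z =ᵐ[P] fun ω => s * Y ω := by
  have mY := memLp_two_of_map_eq_gaussianReal hY h
  have mZ := memLp_two_of_map_eq_gaussianReal hZ h'
  have hYY := mY.integrable_mul mY
  have hZZ := mZ.integrable_mul mZ
  have hYZi := mY.integrable_mul mZ
  simp only [Pi.mul_def] at hYY hZZ hYZi
  have h0 : ∫ ω, (Z ω - s * Y ω) ^ 2 ∂P = 0 := by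
    have e : ∀ ω, (Z ω - s * Y ω) ^ 2 =
        Z ω * Z ω - 2 * s * (Y ω * Z ω) + s ^ 2 * (Y ω * Y ω) := fun ω => by ring
    simp only [e]
    have h1 : Integrable (fun ω => Z ω * Z ω - 2 * s * (Y ω * Z ω)) P := hZZ.sub (hYZi.const_mul _)
    rw [integral_add h1 (hYY.const_mul _),
      integral_sub hZZ (hYZi.const_mul _), integral_const_mul, integral_const_mul, hYZ,
      integral_mul_self_of_map_eq_gaussianReal hY h, integral_mul_self_of_map_eq_gaussianReal hZ h']
    linear_combination -hs
  have hi : Integrable (fun ω => (Z ω - s * Y ω) ^ 2) P := by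
    have := (mZ.sub (mY.const_mul s)).integrable_sq
    exact this
  rw [integral_eq_zero_iff_of_nonneg (fun _ => sq_nonneg _) hi] at h0
  filter_upwards [h0] with ω hω
  have := pow_eq_zero_iff two_ne_zero |>.1 hω
  linarith

lemma abs_integral_mul_le_one {Ω : Type*} [MeasurableSpace Ω] {P : Measure Ω}
    [IsProbabilityMeasure P] {Y Z : Ω → ℝ} (hY : Measurable Y) (hZ : Measurable Z)
    (h : P.map Y = gaussianReal 0 1) (h' : P.map Z = gaussianReal 0 1) :
    |∫ ω, Y ω * Z ω ∂P| ≤ 1 := by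
  have mY := memLp_two_of_map_eq_gaussianReal hY h
  have mZ := memLp_two_of_map_eq_gaussianReal hZ h'
  have hYY := mY.integrable_mul mY
  have hZZ := mZ.integrable_mul mZ
  simp only [Pi.mul_def] at hYY hZZ
  calc |∫ ω, Y ω * Z ω ∂P| ≤ ∫ ω, |Y ω * Z ω| ∂P := abs_integral_le_integral_abs
    _ ≤ ∫ ω, (1 / 2) * (Y ω * Y ω) + (1 / 2) * (Z ω * Z ω) ∂P := by
      refine integral_mono (mY.integrable_mul mZ).abs
        ((hYY.const_mul _).add (hZZ.const_mul _)) fun ω => ?_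
      simp only [abs_le]
      constructor <;> nlinarith [sq_nonneg (Y ω + Z ω), sq_nonneg (Y ω - Z ω)]
    _ = 1 := by
      rw [integral_add (hYY.const_mul _) (hZZ.const_mul _), integral_const_mul, integral_const_mul,
        integral_mul_self_of_map_eq_gaussianReal hY h,
        integral_mul_self_of_map_eq_gaussianReal hZ h']
      norm_num

lemma tendsto_zero_of_tendsto_mul_log {r : ℕ → ℝ} {γ : ℝ}
    (hr : Tendsto (fun n => r n * Real.log n) atTop (nhds γ)) : Tendsto r atTop (nhds 0) := by
  have hlog : Tendsto (fun n : ℕ => Real.log n) atTop atTop :=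
    tendsto_log_atTop.comp tendsto_natCast_atTop_atTop
  have := hr.mul hlog.inv_tendsto_atTop
  rw [mul_zero] at this
  refine this.congr' ?_
  filter_upwards [hlog.eventually_gt_atTop 0] with n hn
  simp only [Pi.inv_apply]
  field_simp

lemma exists_abs_le_lt_one {r : ℕ → ℝ} (h0 : Tendsto r atTop (nhds 0))
    (h1 : ∀ k, 1 ≤ k → |r k| < 1) : ∃ δ : ℝ, 1 / 2 ≤ δ ∧ δ < 1 ∧ ∀ k, 1 ≤ k → |r k| ≤ δ := by
  obtain ⟨N, hN⟩ := eventually_atTop.1 (h0.abs.eventually (ge_mem_nhds (by norm_num :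
    |(0 : ℝ)| < 1 / 2)))
  have key : ∀ M, ∃ δ : ℝ, 1 / 2 ≤ δ ∧ δ < 1 ∧ ∀ k, 1 ≤ k → k < M → |r k| ≤ δ := by
    intro M
    induction M with
    | zero => exact ⟨1 / 2, le_rfl, by norm_num, by simp⟩
    | succ M ih =>
      obtain ⟨δ, hδ, hδ1, h⟩ := ih
      rcases Nat.eq_zero_or_pos M with rfl | hM
      · exact ⟨δ, hδ, hδ1, fun k hk hk' => by omega⟩
      · refine ⟨max δ |r M|, le_max_of_le_left hδ, max_lt hδ1 (h1 M hM), fun k hk hk' => ?_⟩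
        rcases (Nat.lt_succ_iff_lt_or_eq.1 hk') with hk' | rfl
        · exact le_max_of_le_left (h k hk hk')
        · exact le_max_right _ _
  obtain ⟨δ, hδ, hδ1, h⟩ := key N
  refine ⟨δ, hδ, hδ1, fun k hk => ?_⟩
  rcases lt_or_ge k N with hk' | hk'
  · exact h k hk hk'
  · exact (hN k hk').trans hδ

lemma abs_covariance_lt_one_of_stationary {Ω : Type*} [MeasurableSpace Ω] {P : Measure Ω}
    [IsProbabilityMeasure P] {X : ℕ → Ω → ℝ} (hXmeas : ∀ n, Measurable (X n))
    (hstd : ∀ n, Measure.map (X n) P = gaussianReal 0 1)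
    (hstat : ∀ (m k : ℕ), Measure.map (fun ω => fun i : Fin m => X (i.1 + 1 + k) ω) P =
      Measure.map (fun ω => fun i : Fin m => X (i.1 + 1) ω) P)
    (h0 : Tendsto (fun n : ℕ => ∫ ω, X 1 ω * X (n + 1) ω ∂P) atTop (nhds 0)) {k : ℕ} (hk : 1 ≤ k) :
    |∫ ω, X 1 ω * X (k + 1) ω ∂P| < 1 := by
  refine lt_of_le_of_ne (abs_integral_mul_le_one (hXmeas _) (hXmeas _) (hstd _) (hstd _)) fun h => ?_
  set s := ∫ ω, X 1 ω * X (k + 1) ω ∂P with hs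
  have hs2 : s ^ 2 = 1 := by rw [← sq_abs, h, one_pow]
  have hstep : ∀ i, X (i + 1 + k) =ᵐ[P] fun ω => s * X (i + 1) ω := fun i =>
    ae_eq_of_integral_mul_eq (hXmeas _) (hXmeas _) (hstd _) (hstd _) hs2
      (integral_mul_eq_of_stationary hXmeas hstat k i)
  have hiter : ∀ j : ℕ, X (j * k + 1) =ᵐ[P] fun ω => s ^ j * X 1 ω := by
    intro j
    induction j with
    | zero => simp
    | succ j ih =>
      have e : (j + 1) * k + 1 = j * k + 1 + k := by ring
      rw [e]
      filter_upwards [hstep (j * k), ih] with ω h1 h2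
      rw [h1, h2]; ring
  have hval : ∀ j : ℕ, |∫ ω, X 1 ω * X (j * k + 1) ω ∂P| = 1 := by
    intro j
    have : ∫ ω, X 1 ω * X (j * k + 1) ω ∂P = ∫ ω, s ^ j * (X 1 ω * X 1 ω) ∂P := by
      refine integral_congr_ae ?_
      filter_upwards [hiter j] with ω hω
      rw [hω]; ring
    rw [this, integral_const_mul, integral_mul_self_of_map_eq_gaussianReal (hXmeas 1) (hstd 1),
      mul_one, abs_pow, h, one_pow]
  have hsub : Tendsto (fun j : ℕ => j * k) atTop atTop :=
    tendsto_id.atTop_mul_const' (by omega)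
  have := (h0.comp hsub).abs
  simp only [Function.comp_def, hval, abs_zero] at this
  exact one_ne_zero (tendsto_nhds_unique tendsto_const_nhds this)

lemma hasGaussianLaw_of_forall_sum {Ω : Type*} [MeasurableSpace Ω] {P : Measure Ω}
    {X : ℕ → Ω → ℝ} (hXmeas : ∀ n, Measurable (X n))
    (hGauss : ∀ (m : ℕ) (idx : Fin m → ℕ) (c : Fin m → ℝ), ∃ v : ℝ≥0,
      Measure.map (fun ω => ∑ i, c i * X (idx i) ω) P = gaussianReal 0 v) (n : ℕ) :
    HasGaussianLaw (fun ω => fun i : Fin n => X (i.1 + 1) ω) P := by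
  refine ⟨isGaussian_of_map_eq_gaussianReal fun L => ?_⟩
  obtain ⟨v, hv⟩ := hGauss n (fun i => i.1 + 1) fun i => L (Pi.single i 1)
  refine ⟨0, v, ?_⟩
  rw [Measure.map_map L.continuous.measurable (measurable_pi_lambda _ fun i => hXmeas _), ← hv]
  congr 1
  ext ω
  simp only [Function.comp_apply]
  rw [← L.coe_coe, LinearMap.pi_apply_eq_sum_univ]
  refine Finset.sum_congr rfl fun i _ => ?_
  rw [smul_eq_mul, mul_comm]
  congr 2
  ext j
  simp [Pi.single_apply, eq_comm]

lemma tendsto_log_natCast_atTop : Tendsto (fun n : ℕ => Real.log n) atTop atTop :=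
  tendsto_log_atTop.comp tendsto_natCast_atTop_atTop

lemma le_un_sq {n : ℕ} (hn : 0 < Real.log n) (y : ℝ) :
    2 * Real.log n + 2 * y - Real.log (Real.log n) - Real.log (4 * π) ≤ un n y ^ 2 := by
  have h2 : 0 < 2 * Real.log n := by linarith
  have ha : 0 < √(2 * Real.log n) := sqrt_pos.2 h2
  have ha2 : √(2 * Real.log n) ^ 2 = 2 * Real.log n := sq_sqrt h2.le
  set a := √(2 * Real.log n)
  set c := Real.log (Real.log n) + Real.log (4 * π) with hc
  have : un n y ^ 2 = a ^ 2 + 2 * (y - c / 2) + ((y - c / 2) / a) ^ 2 := by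
    simp only [un]
    change (y / a + (a - c / (2 * a))) ^ 2 = _
    field_simp
    ring
  rw [this, ha2]
  nlinarith [sq_nonneg ((y - c / 2) / a)]

lemma eventually_un_nonneg (y : ℝ) : ∀ᶠ n : ℕ in atTop, 0 ≤ un n y := by
  filter_upwards [tendsto_log_natCast_atTop.eventually_ge_atTop (1 + |Real.log (4 * π) - 2 * y|)]
    with n hn
  have hl1 : 1 ≤ Real.log n := by linarith [abs_nonneg (Real.log (4 * π) - 2 * y)]
  have h2 : 0 < 2 * Real.log n := by linarith
  have ha : 0 < √(2 * Real.log n) := sqrt_pos.2 h2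
  have ha2 : √(2 * Real.log n) ^ 2 = 2 * Real.log n := sq_sqrt h2.le
  have hL : Real.log (Real.log n) ≤ Real.log n - 1 := log_le_sub_one_of_pos (by linarith)
  have e : un n y = (√(2 * Real.log n) ^ 2 + y -
      (Real.log (Real.log n) + Real.log (4 * π)) / 2) / √(2 * Real.log n) := by
    simp only [un]
    field_simp
    ring
  rw [e, ha2]
  have := le_abs_self (Real.log (4 * π) - 2 * y)
  exact div_nonneg (by linarith) ha.le

lemma sum_log_div_le (n : ℕ) : ∑ k ∈ Finset.Ico 1 n, (Real.log n - Real.log k) ≤ n := by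
  rcases Nat.eq_zero_or_pos n with rfl | hn
  · simp
  have hsum : ∑ k ∈ Finset.Ico 1 n, Real.log k + Real.log n = Real.log (n.factorial) := by
    rw [← Finset.prod_Ico_id_eq_factorial, Nat.cast_prod, Real.log_prod,
      Finset.sum_Ico_succ_top (by omega)]
    intro k hk
    have := (Finset.mem_Ico.1 hk).1
    positivity
  have hpow : n * Real.log n - Real.log n.factorial ≤ n := by
    have h := Real.pow_div_factorial_le_exp (x := n) (by positivity) n
    have hn' : (0 : ℝ) < n := by exact_mod_cast hn
    have h' := Real.log_le_log (by positivity) h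
    rwa [Real.log_exp, Real.log_div (by positivity) (by positivity), Real.log_pow] at h'
  rw [Finset.sum_sub_distrib, Finset.sum_const, Nat.card_Ico, nsmul_eq_mul, Nat.cast_pred hn]
  linarith

lemma card_filter_log_lt_le (n : ℕ) (s : ℝ) :
    (((Finset.Ico 1 n).filter fun k : ℕ => Real.log k < s).card : ℝ) ≤ exp s := by
  have hsub : (Finset.Ico 1 n).filter (fun k : ℕ => Real.log k < s) ⊆ Finset.Icc 1 ⌊exp s⌋₊ := by
    intro k hk
    simp only [Finset.mem_filter, Finset.mem_Ico] at hk
    rw [Finset.mem_Icc]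
    refine ⟨hk.1.1, Nat.le_floor ?_⟩
    have hk0 : (0 : ℝ) < k := by exact_mod_cast hk.1.1
    rw [← exp_log hk0]
    exact exp_le_exp.2 hk.2.le
  calc _ ≤ ((Finset.Icc 1 ⌊exp s⌋₊).card : ℝ) := by exact_mod_cast Finset.card_le_card hsub
    _ = (⌊exp s⌋₊ : ℝ) := by simp
    _ ≤ exp s := Nat.floor_le (exp_pos _).le

lemma tendsto_exp_first {α δ : ℝ} (hα : 0 < α) (hδ : 0 < 1 + δ)
    (hαδ : 2 / (1 + δ) = 1 + 2 * α) (y : ℝ) :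
    Tendsto (fun n : ℕ => exp ((1 + α) * Real.log n - (2 * Real.log n + 2 * y -
      Real.log (Real.log n) - Real.log (4 * π)) / (1 + δ))) atTop (nhds 0) := by
  rw [tendsto_exp_comp_nhds_zero]
  have hb : Tendsto (fun n : ℕ => -(α / 2) * Real.log n + (Real.log (4 * π) - 2 * y) / (1 + δ))
      atTop atBot :=
    tendsto_atBot_add_const_right _ _
      (tendsto_log_natCast_atTop.const_mul_atTop_of_neg (by linarith))
  refine tendsto_atBot_mono' _ ?_ hb
  have hlit := (isLittleO_log_id_atTop.comp_tendsto tendsto_log_natCast_atTop).bound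
    (show 0 < (α / 2) * (1 + δ) by positivity)
  filter_upwards [hlit, tendsto_log_natCast_atTop.eventually_ge_atTop 0] with n hn h0
  simp only [Function.comp_apply, id, norm_eq_abs] at hn
  rw [abs_of_nonneg h0] at hn
  have h1 : Real.log (Real.log n) / (1 + δ) ≤ α / 2 * Real.log n := by
    rw [div_le_iff₀ hδ]
    nlinarith [le_abs_self (Real.log (Real.log n))]
  have e : (2 * Real.log n + 2 * y - Real.log (Real.log n) - Real.log (4 * π)) / (1 + δ) =
      2 / (1 + δ) * Real.log n - (Real.log (4 * π) - 2 * y) / (1 + δ) -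
        Real.log (Real.log n) / (1 + δ) := by
    field_simp
    ring
  rw [e, hαδ]
  linarith

/-- Berman's condition: the error term in the normal comparison at the levels `un n y` vanishes. -/
lemma tendsto_comparison_sum {r : ℕ → ℝ} {γ δ : ℝ} (hγ : 0 ≤ γ) (hδ : 1 / 2 ≤ δ) (hδ1 : δ < 1)
    (hr : Tendsto (fun n => r n * Real.log n) atTop (nhds γ)) (hrδ : ∀ k, 1 ≤ k → |r k| ≤ δ)
    (y : ℝ) :
    Tendsto (fun n : ℕ => n * ∑ k ∈ Finset.Ico 1 n, |r k - γ / Real.log n| *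
      exp (-un n y ^ 2 / (1 + max |r k| (γ / Real.log n)))) atTop (nhds 0) := by
  have hδ0 : 0 < 1 + δ := by linarith
  obtain ⟨α, hαdef⟩ : ∃ α, α = (1 - δ) / (2 * (1 + δ)) := ⟨_, rfl⟩
  have hα : 0 < α := by rw [hαdef]; exact div_pos (by linarith) (by linarith)
  have hαδ : 2 / (1 + δ) = 1 + 2 * α := by rw [hαdef]; field_simp; ring
  obtain ⟨M, hM⟩ : ∃ M, ∀ k : ℕ, |r k * Real.log k| ≤ M := by
    obtain ⟨M, hM⟩ := hr.norm.bddAbove_range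
    exact ⟨M, fun k => hM ⟨k, rfl⟩⟩
  have hM0 : 0 ≤ M := (abs_nonneg _).trans (hM 0)
  set W := M / α + γ with hW
  have hW0 : 0 ≤ W := by positivity
  set c := Real.log (4 * π) with hc
  set C := exp (3 * W) * exp (-2 * y + c) with hC
  have hces : Tendsto (fun n : ℕ => (n : ℝ)⁻¹ * ∑ k ∈ Finset.range n, |r k * Real.log k - γ|)
      atTop (nhds 0) := by
    have h : Tendsto (fun k : ℕ => |r k * Real.log k - γ|) atTop (nhds 0) := by
      have := (hr.sub_const γ).abs
      simpa using this
    exact h.cesaro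
  have hbnd : Tendsto (fun n : ℕ => 2 * exp ((1 + α) * Real.log n - (2 * Real.log n + 2 * y -
      Real.log (Real.log n) - c) / (1 + δ)) + (C / α * ((n : ℝ)⁻¹ * ∑ k ∈ Finset.range n,
        |r k * Real.log k - γ|) + C * γ / α * (Real.log n)⁻¹)) atTop (nhds 0) := by
    have := ((tendsto_exp_first hα hδ0 hαδ y).const_mul 2).add ((hces.const_mul (C / α)).add
      (tendsto_log_natCast_atTop.inv_tendsto_atTop.const_mul (C * γ / α)))
    simpa using this
  refine tendsto_of_tendsto_of_tendsto_of_le_of_le' tendsto_const_nhds hbnd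
    (Eventually.of_forall fun n => by positivity) ?_
  have hlit := (isLittleO_log_id_atTop.comp_tendsto tendsto_log_natCast_atTop).bound
    (show (0 : ℝ) < 1 / 2 by norm_num)
  filter_upwards [tendsto_log_natCast_atTop.eventually_ge_atTop (2 + 2 * |2 * y - c|), hlit,
    tendsto_log_natCast_atTop.eventually_ge_atTop (2 * γ), eventually_gt_atTop 0] with n hn hL hγn hn0
  have hn0' : (0 : ℝ) < n := by exact_mod_cast hn0
  simp only [Function.comp_apply, id, norm_eq_abs] at hL
  have habs := abs_nonneg (2 * y - c)
  set ℓ := Real.log n with hℓ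
  have hℓ1 : 1 ≤ ℓ := by linarith
  have hℓ0 : 0 < ℓ := by linarith
  have hL0 : 0 ≤ Real.log ℓ := Real.log_nonneg hℓ1
  rw [abs_of_nonneg hL0, abs_of_pos hℓ0] at hL
  set T := 2 * ℓ + 2 * y - Real.log ℓ - c with hT
  have hT0 : 0 ≤ T := by linarith [neg_abs_le (2 * y - c)]
  have hT3 : T ≤ 3 * ℓ := by linarith [le_abs_self (2 * y - c)]
  have hTu : T ≤ un n y ^ 2 := le_un_sq hℓ0 y
  have hρ0 : 0 ≤ γ / ℓ := by positivity
  have hρδ : γ / ℓ ≤ δ := by rw [div_le_iff₀ hℓ0]; nlinarith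
  have hexpT : exp (-T) = exp (-2 * y + c) * ℓ / (n : ℝ) ^ 2 := by
    have : -T = (-2 * y + c) + Real.log ℓ - (ℓ + ℓ) := by rw [hT]; ring
    rw [this, exp_sub, exp_add, exp_log hℓ0, exp_add ℓ ℓ, hℓ, exp_log hn0', sq]
  set w : ℕ → ℝ := fun k => max |r k| (γ / ℓ) with hw
  have hw0 : ∀ k, 0 ≤ w k := fun k => le_max_of_le_right hρ0
  have hA : ∀ k ∈ Finset.Ico 1 n,
      |r k - γ / ℓ| * exp (-un n y ^ 2 / (1 + w k)) ≤ 2 * exp (-T / (1 + δ)) := by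
    intro k hk
    have hk1 := (Finset.mem_Ico.1 hk).1
    have h1 : |r k - γ / ℓ| ≤ 2 := by
      have := abs_le.1 (hrδ k hk1)
      rw [abs_le]; constructor <;> linarith
    refine mul_le_mul h1 (exp_le_exp.2 ?_) (exp_pos _).le zero_le_two
    rw [neg_div, neg_div, neg_le_neg_iff]
    have hwδ : w k ≤ δ := max_le (hrδ k hk1) hρδ
    exact div_le_div₀ (sq_nonneg _) hTu (by linarith [hw0 k]) (by linarith)
  have hB : ∀ k ∈ Finset.Ico 1 n, α * ℓ ≤ Real.log k →
      |r k - γ / ℓ| * exp (-un n y ^ 2 / (1 + w k)) ≤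
        C / (n : ℝ) ^ 2 * (1 / α * |r k * Real.log k - γ| + γ / (α * ℓ) * (ℓ - Real.log k)) := by
    intro k hk hkl
    have hαℓ : 0 < α * ℓ := by positivity
    have hk0 : 0 < Real.log k := hαℓ.trans_le hkl
    have hrk : |r k| ≤ M / (α * ℓ) := by
      have h1 := hM k
      rw [abs_mul, abs_of_pos hk0] at h1
      rw [le_div_iff₀ hαℓ]
      exact (mul_le_mul_of_nonneg_left hkl (abs_nonneg _)).trans h1
    have hwW : w k * ℓ ≤ W := by
      have h1 : w k ≤ W / ℓ := by
        refine max_le (hrk.trans ?_) ?_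
        · rw [← div_div]
          exact div_le_div_of_nonneg_right (by linarith) hℓ0.le
        · exact div_le_div_of_nonneg_right (by rw [hW]; linarith [div_nonneg hM0 hα.le]) hℓ0.le
      rwa [le_div_iff₀ hℓ0] at h1
    have hexp : exp (-un n y ^ 2 / (1 + w k)) ≤ C * ℓ / (n : ℝ) ^ 2 := by
      calc exp (-un n y ^ 2 / (1 + w k)) ≤ exp (3 * W + -T) := by
            refine exp_le_exp.2 ?_
            rw [neg_div, neg_le, le_div_iff₀ (by linarith [hw0 k])]
            have h1 : w k * T ≤ 3 * W := by nlinarith [hw0 k]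
            nlinarith [hw0 k, mul_nonneg hW0 (hw0 k)]
        _ = _ := by rw [exp_add, hexpT, hC]; ring
    have hlin : ℓ * |r k - γ / ℓ| ≤ 1 / α * |r k * Real.log k - γ| +
        γ / (α * ℓ) * (ℓ - Real.log k) := by
      have hkn : Real.log k ≤ ℓ := Real.log_le_log
        (by exact_mod_cast (Finset.mem_Ico.1 hk).1)
        (by exact_mod_cast (Finset.mem_Ico.1 hk).2.le)
      have hq : ℓ / Real.log k ≤ 1 / α := by
        rw [div_le_div_iff₀ hk0 hα]; linarith
      have e : ℓ * (r k - γ / ℓ) = ℓ / Real.log k * (r k * Real.log k - γ) +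
          γ / Real.log k * (ℓ - Real.log k) := by
        field_simp; ring
      rw [← abs_of_pos hℓ0, ← abs_mul, abs_of_pos hℓ0, e]
      refine (abs_add_le _ _).trans (add_le_add ?_ ?_)
      · rw [abs_mul, abs_of_pos (div_pos hℓ0 hk0)]
        exact mul_le_mul_of_nonneg_right hq (abs_nonneg _)
      · rw [abs_of_nonneg (mul_nonneg (div_nonneg hγ hk0.le) (by linarith))]
        exact mul_le_mul_of_nonneg_right (div_le_div_of_nonneg_left hγ hαℓ hkl) (by linarith)
    calc _ ≤ |r k - γ / ℓ| * (C * ℓ / (n : ℝ) ^ 2) :=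
          mul_le_mul_of_nonneg_left hexp (abs_nonneg _)
      _ = C / (n : ℝ) ^ 2 * (ℓ * |r k - γ / ℓ|) := by ring
      _ ≤ _ := mul_le_mul_of_nonneg_left hlin (by positivity)
  have hB0 : ∀ k ∈ Finset.Ico 1 n,
      0 ≤ C / (n : ℝ) ^ 2 * (1 / α * |r k * Real.log k - γ| + γ / (α * ℓ) * (ℓ - Real.log k)) := by
    intro k hk
    have hkn : Real.log k ≤ ℓ := Real.log_le_log
        (by exact_mod_cast (Finset.mem_Ico.1 hk).1)
        (by exact_mod_cast (Finset.mem_Ico.1 hk).2.le)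
    have : 0 ≤ ℓ - Real.log k := by linarith
    positivity
  rw [← Finset.sum_filter_add_sum_filter_not _ fun k : ℕ => Real.log k < α * ℓ, mul_add]
  refine add_le_add ?_ ?_
  · calc _ ≤ (n : ℝ) * ∑ k ∈ (Finset.Ico 1 n).filter (fun k : ℕ => Real.log k < α * ℓ),
          2 * exp (-T / (1 + δ)) :=
          mul_le_mul_of_nonneg_left (Finset.sum_le_sum fun k hk =>
            hA k (Finset.mem_filter.1 hk).1) hn0'.le
      _ ≤ (n : ℝ) * (exp (α * ℓ) * (2 * exp (-T / (1 + δ)))) := by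
          rw [Finset.sum_const, nsmul_eq_mul]
          exact mul_le_mul_of_nonneg_left (mul_le_mul_of_nonneg_right
            (card_filter_log_lt_le n _) (by positivity)) hn0'.le
      _ = _ := by
          have : (1 + α) * ℓ - T / (1 + δ) = ℓ + α * ℓ + -T / (1 + δ) := by ring
          rw [this, exp_add, exp_add, hℓ, exp_log hn0']
          ring
  · calc _ ≤ (n : ℝ) * ∑ k ∈ (Finset.Ico 1 n).filter (fun k : ℕ => ¬ Real.log k < α * ℓ),
          C / (n : ℝ) ^ 2 * (1 / α * |r k * Real.log k - γ| + γ / (α * ℓ) * (ℓ - Real.log k)) :=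
          mul_le_mul_of_nonneg_left (Finset.sum_le_sum fun k hk =>
            hB k (Finset.mem_filter.1 hk).1 (not_lt.1 (Finset.mem_filter.1 hk).2)) hn0'.le
      _ ≤ (n : ℝ) * ∑ k ∈ Finset.Ico 1 n,
          C / (n : ℝ) ^ 2 * (1 / α * |r k * Real.log k - γ| + γ / (α * ℓ) * (ℓ - Real.log k)) :=
          mul_le_mul_of_nonneg_left (Finset.sum_le_sum_of_subset_of_nonneg
            (Finset.filter_subset _ _) fun k hk _ => hB0 k hk) hn0'.le
      _ = C / n * (1 / α * ∑ k ∈ Finset.Ico 1 n, |r k * Real.log k - γ| +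
          γ / (α * ℓ) * ∑ k ∈ Finset.Ico 1 n, (ℓ - Real.log k)) := by
          rw [← Finset.mul_sum, Finset.sum_add_distrib, ← Finset.mul_sum, ← Finset.mul_sum]
          field_simp
      _ ≤ C / n * (1 / α * ∑ k ∈ Finset.range n, |r k * Real.log k - γ| + γ / (α * ℓ) * n) := by
          refine mul_le_mul_of_nonneg_left (add_le_add ?_ ?_) (by positivity)
          · refine mul_le_mul_of_nonneg_left (Finset.sum_le_sum_of_subset_of_nonneg ?_
              fun _ _ _ => abs_nonneg _) (by positivity)
            intro k hk
            exact Finset.mem_range.2 (Finset.mem_Ico.1 hk).2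
          · exact mul_le_mul_of_nonneg_left (sum_log_div_le n) (by positivity)
      _ = _ := by field_simp

lemma sum_sum_erase_le (n : ℕ) {F : ℕ → ℝ} (hF : ∀ k, 0 ≤ F k) :
    ∑ i : Fin n, ∑ j ∈ Finset.univ.erase i, F ((i : ℕ) - j + (j - i)) ≤
      2 * (n * ∑ k ∈ Finset.Ico 1 n, F k) := by
  have key : ∀ (s : Finset (Fin n)) (f : Fin n → ℕ), Set.InjOn f s →
      (∀ j ∈ s, f j ∈ Finset.Ico 1 n) → ∑ j ∈ s, F (f j) ≤ ∑ k ∈ Finset.Ico 1 n, F k := by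
    intro s f hf hs
    rw [← Finset.sum_image (f := F) hf]
    refine Finset.sum_le_sum_of_subset_of_nonneg ?_ fun k _ _ => hF k
    intro k hk
    obtain ⟨j, hj, rfl⟩ := Finset.mem_image.1 hk
    exact hs j hj
  have hi : ∀ i : Fin n, ∑ j ∈ Finset.univ.erase i, F ((i : ℕ) - j + (j - i)) ≤
      2 * ∑ k ∈ Finset.Ico 1 n, F k := by
    intro i
    rw [← Finset.sum_filter_add_sum_filter_not _ fun j : Fin n => j < i, two_mul]
    refine add_le_add (key _ _ ?_ ?_) (key _ _ ?_ ?_)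
    · intro a ha b hb hab
      simp only [Finset.coe_filter, Set.mem_ofPred_eq] at ha hb hab
      have := ha.2; have := hb.2
      ext; omega
    · intro a ha
      simp only [Finset.mem_filter] at ha
      have := ha.2; have := a.2; have := i.2
      rw [Finset.mem_Ico]; omega
    · intro a ha b hb hab
      simp only [Finset.coe_filter, Set.mem_ofPred_eq] at ha hb hab
      have := ha.2; have := hb.2
      ext; omega
    · intro a ha
      simp only [Finset.mem_filter, Finset.mem_erase] at ha
      have h1 := ha.2; have h2 := a.2; have h3 := i.2
      have h4 : (a : ℕ) ≠ i := fun h => ha.1.1 (Fin.ext h)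
      rw [Finset.mem_Ico]; omega
  calc _ ≤ ∑ i : Fin n, 2 * ∑ k ∈ Finset.Ico 1 n, F k := Finset.sum_le_sum fun i _ => hi i
    _ = _ := by simp; ring

lemma abs_integral_prod_step_sub_mixture_le_of_stationary {Ω κ : Type*} [MeasurableSpace Ω]
    [Fintype κ] {P : Measure Ω} [IsProbabilityMeasure P] {X : ℕ → Ω → ℝ}
    (hXmeas : ∀ n, Measurable (X n))
    (hGauss : ∀ (m : ℕ) (idx : Fin m → ℕ) (c : Fin m → ℝ), ∃ v : ℝ≥0,
      Measure.map (fun ω => ∑ i, c i * X (idx i) ω) P = gaussianReal 0 v)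
    (hstd : ∀ n, Measure.map (X n) P = gaussianReal 0 1)
    (hstat : ∀ (m k : ℕ), Measure.map (fun ω => fun i : Fin m => X (i.1 + 1 + k) ω) P =
      Measure.map (fun ω => fun i : Fin m => X (i.1 + 1) ω) P)
    {r : ℕ → ℝ} (hr : ∀ d, r d = ∫ ω, X 1 ω * X (d + 1) ω ∂P) {δ : ℝ} (hδ1 : δ < 1)
    (hrδ : ∀ k, 1 ≤ k → |r k| ≤ δ) {n : ℕ} {ρ : ℝ} (hρ0 : 0 ≤ ρ) (hρδ : ρ ≤ δ)
    {α : Fin n → κ → ℝ} (hα : ∀ j k, 0 ≤ α j k) (hα1 : ∀ j, ∑ k, α j k ≤ 1)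
    {c : κ → ℝ} {u : ℝ} (hu : 0 ≤ u) (hc : ∀ k, u ≤ c k) :
    |∫ ω, ∏ j : Fin n, (1 - ∑ k, α j k * (if c k < X (j + 1) ω then 1 else 0)) ∂P -
      ∫ z, ∏ j, (1 - ∑ k, α j k * (gaussianReal 0 1).real {t | c k < √(1 - ρ) * t + √ρ * z})
        ∂(gaussianReal 0 1)| ≤
      (1 - δ)⁻¹ / 2 * (n * ∑ k ∈ Finset.Ico 1 n, |r k - ρ| *
        exp (-u ^ 2 / (1 + max |r k| ρ))) := by
  have hcov : ∀ i j : Fin n, cov[X (i + 1), X (j + 1); P] = r ((i : ℕ) - j + (j - i)) := by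
    intro i j
    rw [covariance_of_map_eq_gaussianReal (hXmeas _) (hXmeas _) (hstd _) (hstd _), hr]
    rcases le_total (i : ℕ) j with h | h
    · have := integral_mul_eq_of_stationary hXmeas hstat ((i : ℕ) - j + (j - i)) i
      rw [show (i : ℕ) + 1 + ((i : ℕ) - j + (j - i)) = j + 1 by omega] at this
      exact this
    · have := integral_mul_eq_of_stationary hXmeas hstat ((i : ℕ) - j + (j - i)) j
      rw [show (j : ℕ) + 1 + ((i : ℕ) - j + (j - i)) = i + 1 by omega] at this
      rw [← this]
      simp only [mul_comm]
  have hpos : ∀ i j : Fin n, i ≠ j → 1 ≤ (i : ℕ) - j + (j - i) := by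
    intro i j hij
    have : (i : ℕ) ≠ j := fun h => hij (Fin.ext h)
    omega
  set w : Fin n → Fin n → ℝ := fun i j => max |r ((i : ℕ) - j + (j - i))| ρ with hw
  have hwδ : ∀ i j, i ≠ j → w i j ≤ δ := fun i j hij => max_le (hrδ _ (hpos i j hij)) hρδ
  have hmain := abs_integral_prod_step_sub_mixture_le (P := P)
    (U := fun (i : Fin n) => X (i + 1)) (hasGaussianLaw_of_forall_sum hXmeas hGauss n)
    (fun i => hXmeas _) (fun i => integral_eq_zero_of_map_eq_gaussianReal (hXmeas _) (hstd _))
    (fun i => by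
      rw [covariance_of_map_eq_gaussianReal (hXmeas _) (hXmeas _) (hstd _) (hstd _)]
      exact integral_mul_self_of_map_eq_gaussianReal (hXmeas _) (hstd _))
    hρ0 (hρδ.trans hδ1.le) (w := w) (fun i j hij => (hwδ i j hij).trans_lt hδ1)
    (fun i j _ => by rw [hcov]; exact le_max_left _ _) (fun i j _ => le_max_right _ _)
    hα hα1 hu hc
  rw [show (fun a b : Fin n => Classical.propDecidable (a = b)) = instDecidableEqFin n from
    Subsingleton.elim _ _] at hmain
  refine hmain.trans ?_
  have hδ' : 0 < 1 - δ := by linarith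
  set F : ℕ → ℝ := fun k => |r k - ρ| * exp (-u ^ 2 / (1 + max |r k| ρ)) with hF
  have hsum : ∑ i : Fin n, ∑ j ∈ Finset.univ.erase i, |cov[X (i + 1), X (j + 1); P] - ρ| *
      ((2 * π * (1 - w i j))⁻¹ * exp (-u ^ 2 / (1 + w i j))) ≤
      (2 * π * (1 - δ))⁻¹ * ∑ i : Fin n, ∑ j ∈ Finset.univ.erase i, F ((i : ℕ) - j + (j - i)) := by
    rw [Finset.mul_sum]
    refine Finset.sum_le_sum fun i _ => ?_
    rw [Finset.mul_sum]
    refine Finset.sum_le_sum fun j hj => ?_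
    have hij := (Finset.ne_of_mem_erase hj).symm
    rw [hcov, mul_left_comm]
    refine mul_le_mul_of_nonneg_right ?_ (by positivity)
    refine inv_anti₀ (by positivity) (mul_le_mul_of_nonneg_left ?_ (by positivity))
    linarith [hwδ i j hij]
  calc _ ≤ ((2 * π * (1 - δ))⁻¹ * (2 * (n * ∑ k ∈ Finset.Ico 1 n, F k))) * (π / 2) := by
        refine mul_le_mul_of_nonneg_right (hsum.trans ?_) (by positivity)
        exact mul_le_mul_of_nonneg_left (sum_sum_erase_le n fun k => by positivity) (by positivity)
    _ = _ := by field_simp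

lemma measureReal_Ioi_gaussianReal (v : ℝ) :
    (gaussianReal 0 1).real (Set.Ioi v) = 1 - cdf (gaussianReal 0 1) v := by
  rw [cdf_eq_real, ← Set.compl_Iic, probReal_compl_eq_one_sub measurableSet_Iic]

/-- Mills' ratio. -/
lemma tendsto_mills_ratio :
    Tendsto (fun v => (gaussianReal 0 1).real (Set.Ioi v) / (gaussianPDFReal 0 1 v / v)) atTop
      (nhds 1) := by
  have hpdf : ∀ v : ℝ, gaussianPDFReal 0 1 v = (√(2 * π))⁻¹ * exp (-v ^ 2 / 2) := fun v => by
    rw [gaussianPDFReal_def]; simp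
  have hd : ∀ v : ℝ, HasDerivAt (gaussianPDFReal 0 1) (-v * gaussianPDFReal 0 1 v) v := by
    intro v
    rw [show gaussianPDFReal 0 1 = fun v => (√(2 * π))⁻¹ * exp (-v ^ 2 / 2) from funext hpdf]
    have h1 : HasDerivAt (fun v : ℝ => -v ^ 2 / 2) (-v) v :=
      (((hasDerivAt_pow 2 v).neg).div_const 2).congr_deriv (by simp; ring)
    exact (h1.exp.const_mul _).congr_deriv (by ring)
  have hlim : Tendsto (fun v : ℝ => gaussianPDFReal 0 1 v / v) atTop (nhds 0) := by
    refine squeeze_zero' (g := fun v => (√(2 * π))⁻¹ * v⁻¹) ?_ ?_ ?_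
    · filter_upwards [eventually_gt_atTop 0] with v hv
      exact div_nonneg (gaussianPDFReal_nonneg _ _ _) hv.le
    · filter_upwards [eventually_gt_atTop 0] with v hv
      rw [div_eq_mul_inv]
      refine mul_le_mul_of_nonneg_right ?_ (inv_nonneg.2 hv.le)
      have := gaussianPDFReal_le 0 1 v
      simpa using this
    · simpa using tendsto_inv_atTop_zero.const_mul (√(2 * π))⁻¹
  refine HasDerivAt.lhopital_zero_atTop (f' := fun v => -gaussianPDFReal 0 1 v)
    (g' := fun v => -gaussianPDFReal 0 1 v * (1 + (v ^ 2)⁻¹)) ?_ ?_ ?_ ?_ hlim ?_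
  · refine Eventually.of_forall fun v => ?_
    simp only [measureReal_Ioi_gaussianReal]
    exact (hasDerivAt_cdf_gaussianReal v).const_sub 1
  · filter_upwards [eventually_gt_atTop 0] with v hv
    refine ((hd v).div (hasDerivAt_id v) hv.ne').congr_deriv ?_
    simp only [id]
    field_simp
    ring
  · refine Eventually.of_forall fun v => mul_ne_zero (neg_ne_zero.2
      (gaussianPDFReal_pos _ _ _ one_ne_zero).ne') (by positivity)
  · simp only [measureReal_Ioi_gaussianReal]
    simpa using (tendsto_cdf_atTop (gaussianReal 0 1)).const_sub 1
  · have h1 : Tendsto (fun v : ℝ => (1 + (v ^ 2)⁻¹)⁻¹) atTop (nhds 1) := by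
      have := ((tendsto_pow_atTop (α := ℝ) two_ne_zero).inv_tendsto_atTop.const_add 1).inv₀
        (by norm_num)
      simpa using this
    refine h1.congr fun v => ?_
    have := (gaussianPDFReal_pos 0 1 v one_ne_zero).ne'
    rw [div_mul_eq_div_div, div_self (neg_ne_zero.2 this), one_div]

lemma tendsto_nat_mul_gaussian_tail {γ : ℝ} (hγ : 0 ≤ γ) (x z : ℝ) :
    Tendsto (fun n : ℕ => n * (gaussianReal 0 1).real
      {t | un n x < √(1 - γ / Real.log n) * t + √(γ / Real.log n) * z}) atTop
      (nhds (g γ x z)) := by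
  set ℓ : ℕ → ℝ := fun n => Real.log n with hℓ
  have hℓt : Tendsto ℓ atTop atTop := tendsto_log_natCast_atTop
  set c := Real.log (4 * π) with hc
  set e : ℕ → ℝ := fun n => x - (Real.log (ℓ n) + c) / 2 - √(2 * γ) * z with he
  set a : ℕ → ℝ := fun n => √(2 * ℓ n) with ha
  have hsqrt : Tendsto (fun n => √(ℓ n)) atTop atTop := tendsto_sqrt_atTop.comp hℓt
  have hq : Tendsto (fun n => e n / √(ℓ n)) atTop (nhds 0) := by
    have h1 : Tendsto (fun n => Real.log (ℓ n) / √(ℓ n)) atTop (nhds 0) := by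
      have := (isLittleO_log_rpow_atTop (r := 1 / 2) (by norm_num)).tendsto_div_nhds_zero.comp hℓt
      simpa [Function.comp_def, sqrt_eq_rpow] using this
    have h2 := (hsqrt.inv_tendsto_atTop.const_mul (x - c / 2 - √(2 * γ) * z)).sub (h1.const_mul (1 / 2))
    simp only [mul_zero, sub_zero] at h2
    refine h2.congr fun n => ?_
    simp only [he, Pi.inv_apply]
    ring
  set D : ℕ → ℝ := fun n => ((e n / √(ℓ n)) ^ 2 / 4 + γ * (e n / √(ℓ n) * (√(ℓ n))⁻¹) +
    γ ^ 2 * (ℓ n)⁻¹) / (1 - γ * (ℓ n)⁻¹) with hD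
  have hDt : Tendsto D atTop (nhds 0) := by
    have h1 := ((hq.pow 2).div_const 4).add ((hq.mul hsqrt.inv_tendsto_atTop).const_mul γ)
    have h2 := (h1.add (hℓt.inv_tendsto_atTop.const_mul (γ ^ 2))).div
      ((hℓt.inv_tendsto_atTop.const_mul γ).const_sub 1) (by norm_num)
    simp only [hD]
    simpa [Pi.div_def] using h2
  set v : ℕ → ℝ := fun n => (un n x - √(γ / ℓ n) * z) / √(1 - γ / ℓ n) with hv
  have hev : ∀ᶠ n in atTop, 0 < ℓ n ∧ γ / ℓ n < 1 := by
    filter_upwards [hℓt.eventually_gt_atTop γ, hℓt.eventually_gt_atTop 0] with n h1 h2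
    exact ⟨h2, (div_lt_one h2).2 h1⟩
  have hva : ∀ n, 0 < ℓ n → γ / ℓ n < 1 →
      v n = a n * ((1 + e n / √(ℓ n) * (√(ℓ n))⁻¹ / 2) / √(1 - γ * (ℓ n)⁻¹)) := by
    intro n h0 h1
    have hs : √(γ / ℓ n) = √(2 * γ) / a n := by
      rw [ha, ← sqrt_div (by positivity)]
      congr 1
      field_simp
    have ha0 : 0 < a n := sqrt_pos.2 (by linarith)
    have ha2 : a n ^ 2 = 2 * ℓ n := sq_sqrt (by linarith)
    have hs2 : √(ℓ n) ^ 2 = ℓ n := sq_sqrt h0.le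
    have hs0 : 0 < √(ℓ n) := sqrt_pos.2 h0
    have h2 : 0 < √(1 - γ / ℓ n) := sqrt_pos.2 (by linarith)
    simp only [hv]
    rw [hs, ← div_eq_mul_inv γ, ← mul_div_assoc]
    congr 1
    have e1 : e n / √(ℓ n) * (√(ℓ n))⁻¹ / 2 = e n / a n ^ 2 := by
      rw [ha2, ← div_eq_mul_inv, div_div (e n), ← sq, hs2, div_div, mul_comm 2]
    rw [e1]
    simp only [un, he]
    change x / a n + (a n - (Real.log (ℓ n) + c) / (2 * a n)) - _ = _
    field_simp
    ring
  have hratio : Tendsto (fun n => (1 + e n / √(ℓ n) * (√(ℓ n))⁻¹ / 2) / √(1 - γ * (ℓ n)⁻¹)) atTop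
      (nhds 1) := by
    have h1 := (((hq.mul hsqrt.inv_tendsto_atTop).div_const 2).const_add 1).div
      ((hℓt.inv_tendsto_atTop.const_mul γ).const_sub 1).sqrt (by norm_num)
    simpa [Pi.div_def] using h1
  have hat : Tendsto a atTop atTop :=
    tendsto_sqrt_atTop.comp (hℓt.const_mul_atTop two_pos)
  have hvt : Tendsto v atTop atTop := by
    refine (hat.atTop_mul_pos one_pos hratio).congr' ?_
    filter_upwards [hev] with n hn
    exact (hva n hn.1 hn.2).symm
  have hvsq : ∀ n, 0 < ℓ n → γ / ℓ n < 1 → v n ^ 2 / 2 = ℓ n + e n + γ + D n := by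
    intro n h0 h1
    have ha2 : a n ^ 2 = 2 * ℓ n := sq_sqrt (by linarith)
    have hs2 : √(ℓ n) ^ 2 = ℓ n := sq_sqrt h0.le
    have hs0 : 0 < √(ℓ n) := sqrt_pos.2 h0
    have h1' : 0 < ℓ n - γ := by rw [div_lt_one h0] at h1; linarith
    have h2 : 1 - γ * (ℓ n)⁻¹ = (ℓ n - γ) / ℓ n := by field_simp
    rw [hva n h0 h1, mul_pow, ha2, div_pow, sq_sqrt (by rw [h2]; positivity)]
    simp only [hD]
    rw [h2]
    have e1 : e n / √(ℓ n) * (√(ℓ n))⁻¹ = e n / ℓ n := by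
      nth_rewrite 3 [← hs2]; field_simp
    have e2 : (e n / √(ℓ n)) ^ 2 = e n ^ 2 / ℓ n := by rw [div_pow, hs2]
    rw [e1, e2]
    field_simp
    ring
  have hmain := (tendsto_mills_ratio.comp hvt).mul
    (((continuous_exp.tendsto _).comp hDt.neg).const_mul (g γ x z) |>.div hratio one_ne_zero)
  simp only [neg_zero, exp_zero, mul_one, div_one, one_mul] at hmain
  refine hmain.congr' ?_
  filter_upwards [hev, hvt.eventually_gt_atTop 0, eventually_gt_atTop 0] with n hn hv0 hn0
  have hset : {t | un n x < √(1 - γ / ℓ n) * t + √(γ / ℓ n) * z} = Set.Ioi (v n) := by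
    ext t
    have : 0 < √(1 - γ / ℓ n) := sqrt_pos.2 (by linarith [hn.2])
    simp only [Set.mem_ofPred_eq, Set.mem_Ioi, hv]
    rw [div_lt_iff₀ this, sub_lt_iff_lt_add, mul_comm t]
  have hn0' : (0 : ℝ) < n := by exact_mod_cast hn0
  have ha0 : 0 < a n := sqrt_pos.2 (by linarith [hn.1])
  have hpdf : n * gaussianPDFReal 0 1 (v n) = g γ x z * a n * exp (-D n) := by
    have hval : g γ x z * a n * exp (-D n) * √(2 * π) =
        exp (-x - γ + √(2 * γ) * z - D n) * exp ((Real.log (ℓ n) + c) / 2) := by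
      have : a n * √(2 * π) = exp ((Real.log (ℓ n) + c) / 2) := by
        rw [ha, ← sqrt_mul (by linarith [hn.1]), hc, ← Real.log_mul hn.1.ne' (by positivity),
          exp_half, exp_log (by have := hn.1; positivity)]
        congr 1; ring
      rw [← this, sub_eq_add_neg _ (D n), exp_add, g]
      ring
    rw [gaussianPDFReal_def]
    simp only [NNReal.coe_one, mul_one, sub_zero]
    rw [show -(v n) ^ 2 / 2 = -(v n ^ 2 / 2) by ring, hvsq n hn.1 hn.2,
      mul_left_comm, inv_mul_eq_iff_eq_mul₀ (by positivity), mul_comm √(2 * π), hval, ← exp_add]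
    nth_rewrite 1 [← exp_log hn0']
    rw [← exp_add]
    congr 1
    simp only [he, hℓ]
    ring
  simp only [Function.comp_apply, Pi.div_apply]
  rw [hset]
  set q := (1 + e n / √(ℓ n) * (√(ℓ n))⁻¹ / 2) / √(1 - γ * (ℓ n)⁻¹)
  have hvq : v n = a n * q := hva n hn.1 hn.2
  have hq0 : q ≠ 0 := fun h => by rw [h, mul_zero] at hvq; linarith
  have hp0 := (gaussianPDFReal_pos 0 1 (v n) one_ne_zero).ne'
  have : g γ x z * exp (-D n) / q = n * gaussianPDFReal 0 1 (v n) / v n := by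
    rw [hpdf, hvq]; field_simp
  rw [this]
  field_simp

lemma un_le_un (n : ℕ) {x y : ℝ} (hxy : y ≤ x) : un n y ≤ un n x := by
  simp only [un]
  gcongr

lemma prod_Icc_one_eq_prod_fin {M : Type*} [CommMonoid M] (f : ℕ → M) (n : ℕ) :
    ∏ j ∈ Finset.Icc 1 n, f j = ∏ j : Fin n, f (j + 1) := by
  rw [Fin.prod_univ_eq_prod_range (fun j => f (j + 1)), Finset.range_eq_Ico,
    Finset.prod_Ico_add', zero_add]
  rfl

/-- A Poisson limit for products with two kinds of factors. -/
lemma tendsto_prod_one_sub_ite {e : ℕ → Bool} {L : Filter ℕ} (hL : L ≤ atTop) {w₁ w₂ : ℕ → ℝ}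
    {p₁ p₂ lam : ℝ} (h₁ : Tendsto (fun n : ℕ => n * w₁ n) atTop (nhds p₁))
    (h₂ : Tendsto (fun n : ℕ => n * w₂ n) atTop (nhds p₂))
    (hS : Tendsto (fun n : ℕ => (∑ k ∈ Finset.Icc 1 n, (if e k then (1 : ℝ) else 0)) / n)
      L (nhds lam)) :
    Tendsto (fun n => ∏ j ∈ Finset.Icc 1 n, (1 - if e j then w₁ n else w₂ n)) L
      (nhds (exp (-lam * p₁ - (1 - lam) * p₂))) := by
  have hw : ∀ {w : ℕ → ℝ} {p : ℝ}, Tendsto (fun n : ℕ => n * w n) atTop (nhds p) →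
      (∀ᶠ n in atTop, w n < 1) ∧
        Tendsto (fun n : ℕ => n * Real.log (1 - w n)) atTop (nhds (-p)) := by
    intro w p h
    have h0 : Tendsto w atTop (nhds 0) := by
      have := h.mul tendsto_inv_atTop_nhds_zero_nat
      rw [mul_zero] at this
      refine this.congr' ?_
      filter_upwards [eventually_ne_atTop 0] with n hn
      field_simp
    refine ⟨h0.eventually_lt_const one_pos, ?_⟩
    have := Real.tendsto_nat_mul_log_one_add_of_tendsto (g := fun n => -w n) (t := -p)
      (by simpa using h.neg)
    simpa [sub_eq_add_neg] using this
  obtain ⟨hw₁, hl₁⟩ := hw h₁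
  obtain ⟨hw₂, hl₂⟩ := hw h₂
  have hlim := (hS.mul (hl₁.mono_left hL)).add ((hS.const_sub 1).mul (hl₂.mono_left hL))
  have := (continuous_exp.tendsto _).comp hlim
  rw [show lam * -p₁ + (1 - lam) * -p₂ = -lam * p₁ - (1 - lam) * p₂ by ring] at this
  refine this.congr' ?_
  filter_upwards [hL hw₁, hL hw₂, hL (eventually_ne_atTop 0)] with n hn₁ hn₂ hn
  have hn' : (n : ℝ) ≠ 0 := by exact_mod_cast hn
  have e1 : ∀ j, (1 - if e j then w₁ n else w₂ n) =
      exp ((if e j then (1 : ℝ) else 0) * Real.log (1 - w₁ n) +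
        (1 - if e j then (1 : ℝ) else 0) * Real.log (1 - w₂ n)) := by
    intro j
    cases e j
    · simp [exp_log (sub_pos.2 hn₂)]
    · simp [exp_log (sub_pos.2 hn₁)]
  simp only [Function.comp_apply]
  rw [Finset.prod_congr rfl fun j _ => e1 j, ← exp_sum, Finset.sum_add_distrib,
    ← Finset.sum_mul, ← Finset.sum_mul, Finset.sum_sub_distrib]
  simp only [Finset.sum_const, Nat.card_Icc, add_tsub_cancel_right, nsmul_eq_mul, mul_one]
  congr 1
  field_simp

lemma measurable_gaussianReal_tail (c a b : ℝ) :
    Measurable fun z : ℝ => (gaussianReal 0 1).real {t | c < a * t + b * z} := by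
  refine (measurable_measure_prodMk_left (ν := gaussianReal 0 1)
    (s := {p : ℝ × ℝ | c < a * p.2 + b * p.1}) ?_).ennreal_toReal
  exact measurableSet_lt measurable_const (by fun_prop)

lemma measurable_prod_one_sub {E : Type*} [MeasurableSpace E] {f h : ℕ → E → ℝ} {e : ℕ → E → Bool}
    (hf : ∀ j, Measurable (f j)) (hh : ∀ j, Measurable (h j)) (he : ∀ j, Measurable (e j))
    (β₁ β₂ : ℝ) (s : Finset ℕ) :
    Measurable fun p => ∏ j ∈ s, (1 - (β₁ * f j p + (if e j p then 0 else β₂) * h j p)) :=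
  Finset.measurable_prod _ fun j _ => (((hf j).const_mul _).add ((Measurable.ite
    (he j (measurableSet_singleton true)) measurable_const measurable_const).mul
      (hh j))).const_sub _

lemma norm_prod_one_sub_le {f h : ℕ → ℝ} (hf : ∀ j, f j ∈ Set.Icc 0 1) (hh : ∀ j, h j ∈ Set.Icc 0 1)
    (e : ℕ → Bool) {β₁ β₂ : ℝ} (hβ₁ : 0 ≤ β₁) (hβ₂ : 0 ≤ β₂) (hβ : β₁ + β₂ ≤ 1) (s : Finset ℕ) :
    ‖∏ j ∈ s, (1 - (β₁ * f j + (if e j then 0 else β₂) * h j))‖ ≤ 1 := by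
  rw [norm_prod]
  refine Finset.prod_le_one (fun _ _ => norm_nonneg _) fun j _ => ?_
  obtain ⟨hf0, hf1⟩ := hf j
  obtain ⟨hh0, hh1⟩ := hh j
  rw [Real.norm_eq_abs, abs_le]
  split_ifs <;> constructor <;> nlinarith

lemma tendsto_integral_prod_mixture {Ω : Type*} [MeasurableSpace Ω] {P : Measure Ω}
    [IsProbabilityMeasure P] {ε : ℕ → Ω → Bool} {lam : Ω → ℝ} {γ : ℝ} (hγ : 0 ≤ γ)
    (hεmeas : ∀ n, Measurable (ε n))
    (hS : TendstoInMeasure P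
      (fun n ω => (∑ k ∈ Finset.Icc 1 n, (if ε k ω then (1 : ℝ) else 0)) / n) atTop lam)
    {x y β₁ β₂ : ℝ} (hβ₁ : 0 ≤ β₁) (hβ₂ : 0 ≤ β₂) (hβ : β₁ + β₂ ≤ 1) :
    Tendsto (fun n : ℕ => ∫ p : Ω × ℝ, ∏ j ∈ Finset.Icc 1 n, (1 - (β₁ * (gaussianReal 0 1).real
          {t | un n y < √(1 - γ / Real.log n) * t + √(γ / Real.log n) * p.2} +
        (if ε j p.1 then 0 else β₂) * (gaussianReal 0 1).real
          {t | un n x < √(1 - γ / Real.log n) * t + √(γ / Real.log n) * p.2}))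
        ∂(P.prod (gaussianReal 0 1))) atTop
      (nhds (∫ p : Ω × ℝ, exp (-(β₁ * g γ y p.2) - (1 - lam p.1) * (β₂ * g γ x p.2))
        ∂(P.prod (gaussianReal 0 1)))) := by
  refine tendsto_of_subseq_tendsto fun ns hns => ?_
  obtain ⟨ms, hmono, hms⟩ := TendstoInMeasure.exists_seq_tendsto_ae (f := fun i ω =>
    (∑ k ∈ Finset.Icc 1 (ns i), (if ε k ω then (1 : ℝ) else 0)) / ns i) (g := lam) (μ := P)
    (fun δ hδ => (hS δ hδ).comp hns)
  have hL : map (fun i => ns (ms i)) atTop ≤ atTop := hns.comp hmono.tendsto_atTop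
  refine ⟨ms, tendsto_integral_of_dominated_convergence (fun _ => 1) (fun i => ?_)
    (integrable_const 1) (fun i => ae_of_all _ fun p => ?_) ?_⟩
  · have hm : ∀ c a b, Measurable fun p : Ω × ℝ =>
        (gaussianReal 0 1).real {t | c < a * t + b * p.2} := fun c a b =>
      (measurable_gaussianReal_tail c a b).comp measurable_snd
    exact (measurable_prod_one_sub (fun _ => hm _ _ _) (fun _ => hm _ _ _)
      (fun j => (hεmeas j).comp measurable_fst) _ _ _).aestronglyMeasurable
  · exact norm_prod_one_sub_le (fun _ => ⟨measureReal_nonneg, measureReal_le_one⟩)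
      (fun _ => ⟨measureReal_nonneg, measureReal_le_one⟩) _ hβ₁ hβ₂ hβ _
  · filter_upwards [Measure.quasiMeasurePreserving_fst.ae hms] with p hp
    have h₁ := (tendsto_nat_mul_gaussian_tail hγ y p.2).const_mul β₁
    have h₂ := (tendsto_nat_mul_gaussian_tail hγ x p.2).const_mul β₂
    have := tendsto_prod_one_sub_ite (e := fun k => ε k p.1) hL (h₁.congr fun n => mul_left_comm _ _ _)
      ((h₁.add h₂).congr fun n => (by rw [mul_left_comm, mul_left_comm β₂, ← mul_add])) (lam := lam p.1) hp
    rw [tendsto_map'_iff] at this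
    rw [show -(β₁ * g γ y p.2) - (1 - lam p.1) * (β₂ * g γ x p.2) = -lam p.1 * (β₁ * g γ y p.2) -
      (1 - lam p.1) * (β₁ * g γ y p.2 + β₂ * g γ x p.2) by ring]
    refine this.congr fun i => Finset.prod_congr rfl fun j _ => ?_
    cases ε j p.1 <;> simp

lemma integral_comp_prodMk_of_indepFun {Ω α β : Type*} [MeasurableSpace Ω] [MeasurableSpace α]
    [MeasurableSpace β] {P : Measure Ω} [IsProbabilityMeasure P] {f : Ω → α} {h : Ω → β}
    (hf : Measurable f) (hh : Measurable h) (hfh : IndepFun f h P) {F : α × β → ℝ}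
    (hF : Measurable F) {C : ℝ} (hC : ∀ p, ‖F p‖ ≤ C) :
    ∫ ω, F (f ω, h ω) ∂P = ∫ ω', ∫ ω, F (f ω, h ω') ∂P ∂P := by
  have hmap := (indepFun_iff_map_prod_eq_prod_map_map hf.aemeasurable hh.aemeasurable).1 hfh
  have : IsProbabilityMeasure (P.map f) := Measure.isProbabilityMeasure_map hf.aemeasurable
  have : IsProbabilityMeasure (P.map h) := Measure.isProbabilityMeasure_map hh.aemeasurable
  have hint : Integrable F ((P.map f).prod (P.map h)) :=
    .of_bound hF.aestronglyMeasurable C (ae_of_all _ hC)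
  rw [← integral_map (hf.prodMk hh).aemeasurable hF.aestronglyMeasurable, hmap,
    integral_prod_symm _ hint, integral_map hh.aemeasurable]
  · refine integral_congr_ae (ae_of_all _ fun ω' => ?_)
    exact integral_map hf.aemeasurable
      (hF.comp (measurable_id.prodMk measurable_const)).aestronglyMeasurable
  · exact hF.stronglyMeasurable.integral_prod_left'.aestronglyMeasurable

lemma tendsto_integral_prod_one_sub {Ω : Type*} [MeasurableSpace Ω] {P : Measure Ω}
    [IsProbabilityMeasure P] {X : ℕ → Ω → ℝ} {ε : ℕ → Ω → Bool} {lam : Ω → ℝ} {γ : ℝ}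
    (hγ : 0 ≤ γ) (hXmeas : ∀ n, Measurable (X n)) (hεmeas : ∀ n, Measurable (ε n))
    (hGauss : ∀ (m : ℕ) (idx : Fin m → ℕ) (c : Fin m → ℝ), ∃ v : ℝ≥0,
      Measure.map (fun ω => ∑ i, c i * X (idx i) ω) P = gaussianReal 0 v)
    (hstd : ∀ n, Measure.map (X n) P = gaussianReal 0 1)
    (hstat : ∀ (m k : ℕ), Measure.map (fun ω => fun i : Fin m => X (i.1 + 1 + k) ω) P =
      Measure.map (fun ω => fun i : Fin m => X (i.1 + 1) ω) P)
    (hr : Tendsto (fun n : ℕ => (∫ ω, X 1 ω * X (n + 1) ω ∂P) * Real.log n) atTop (nhds γ))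
    (hindep : IndepFun (fun ω => fun n => X n ω) (fun ω => fun n => ε n ω) P)
    (hS : TendstoInMeasure P
      (fun n ω => (∑ k ∈ Finset.Icc 1 n, (if ε k ω then (1 : ℝ) else 0)) / n) atTop lam)
    {x y β₁ β₂ : ℝ} (hxy : y ≤ x) (hβ₁ : 0 ≤ β₁) (hβ₂ : 0 ≤ β₂) (hβ : β₁ + β₂ ≤ 1) :
    Tendsto (fun n : ℕ => ∫ ω, ∏ j ∈ Finset.Icc 1 n, (1 - (β₁ * (if un n y < X j ω then 1 else 0) +
        (if ε j ω then 0 else β₂) * (if un n x < X j ω then 1 else 0))) ∂P) atTop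
      (nhds (∫ p : Ω × ℝ, exp (-(β₁ * g γ y p.2) - (1 - lam p.1) * (β₂ * g γ x p.2))
        ∂(P.prod (gaussianReal 0 1)))) := by
  obtain ⟨r, hrdef⟩ : ∃ r : ℕ → ℝ, ∀ d, r d = ∫ ω, X 1 ω * X (d + 1) ω ∂P := ⟨_, fun _ => rfl⟩
  simp only [← hrdef] at hr
  have h0 := tendsto_zero_of_tendsto_mul_log hr
  obtain ⟨δ, hδ, hδ1, hrδ⟩ := exists_abs_le_lt_one h0 fun k hk => by
    rw [hrdef]
    exact abs_covariance_lt_one_of_stationary hXmeas hstd hstat (h0.congr hrdef) hk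
  have herr := (tendsto_comparison_sum hγ hδ hδ1 hr hrδ y).const_mul ((1 - δ)⁻¹ / 2)
  rw [mul_zero] at herr
  refine (tendsto_integral_prod_mixture hγ hεmeas hS hβ₁ hβ₂ hβ (x := x) (y := y)).congr_dist
    (squeeze_zero' (Eventually.of_forall fun _ => dist_nonneg) ?_ herr)
  have hρ : ∀ᶠ n : ℕ in atTop, 0 < Real.log n ∧ γ / Real.log n ≤ δ := by
    filter_upwards [tendsto_log_natCast_atTop.eventually_gt_atTop 0,
      tendsto_log_natCast_atTop.eventually_ge_atTop (γ / δ)] with n h1 h2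
    refine ⟨h1, ?_⟩
    rw [div_le_iff₀ (by linarith)] at h2
    rw [div_le_iff₀ h1]; linarith
  filter_upwards [hρ, eventually_un_nonneg y] with n hn hun
  set ρ := γ / Real.log n
  set Δ := (1 - δ)⁻¹ / 2 * (n * ∑ k ∈ Finset.Ico 1 n, |r k - ρ| *
    exp (-un n y ^ 2 / (1 + max |r k| ρ))) with hΔ
  set A : Ω → ℝ := fun ω' => ∫ ω, ∏ j ∈ Finset.Icc 1 n,
    (1 - (β₁ * (if un n y < X j ω then 1 else 0) +
        (if ε j ω' then 0 else β₂) * (if un n x < X j ω then 1 else 0))) ∂P with hA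
  set Q : Ω × ℝ → ℝ := fun p => ∏ j ∈ Finset.Icc 1 n, (1 - (β₁ * (gaussianReal 0 1).real
          {t | un n y < √(1 - ρ) * t + √ρ * p.2} +
        (if ε j p.1 then 0 else β₂) * (gaussianReal 0 1).real
          {t | un n x < √(1 - ρ) * t + √ρ * p.2})) with hQ
  have hcomp : ∀ ω', |A ω' - ∫ z, Q (ω', z) ∂(gaussianReal 0 1)| ≤ Δ := by
    intro ω'
    have := abs_integral_prod_step_sub_mixture_le_of_stationary hXmeas hGauss hstd hstat hrdef hδ1
      hrδ (n := n) (ρ := ρ) (div_nonneg hγ hn.1.le) hn.2 (κ := Bool)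
      (α := fun j b => if b then β₁ else if ε (j + 1) ω' then 0 else β₂)
      (fun j b => by cases b <;> cases ε (j + 1) ω' <;> simp [hβ₁, hβ₂])
      (fun j => by
        rw [Fintype.sum_bool]; cases ε (j + 1) ω' <;> simp <;> linarith)
      (c := fun b => if b then un n y else un n x) hun
      (fun b => by cases b <;> simp [un_le_un n hxy])
    simp only [Fintype.sum_bool, if_true, Bool.false_eq_true, if_false] at this
    simpa only [hA, hQ, prod_Icc_one_eq_prod_fin] using this
  have hQm : Measurable Q := by
    have hm : ∀ c a b, Measurable fun p : Ω × ℝ =>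
        (gaussianReal 0 1).real {t | c < a * t + b * p.2} := fun c a b =>
      (measurable_gaussianReal_tail c a b).comp measurable_snd
    exact measurable_prod_one_sub (fun _ => hm _ _ _) (fun _ => hm _ _ _)
      (fun j => (hεmeas j).comp measurable_fst) _ _ _
  have hQi : Integrable Q (P.prod (gaussianReal 0 1)) :=
    .of_bound hQm.aestronglyMeasurable 1 (ae_of_all _ fun p =>
      norm_prod_one_sub_le (fun _ => ⟨measureReal_nonneg, measureReal_le_one⟩)
        (fun _ => ⟨measureReal_nonneg, measureReal_le_one⟩) _ hβ₁ hβ₂ hβ _)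
  set F : (ℕ → ℝ) × (ℕ → Bool) → ℝ := fun q => ∏ j ∈ Finset.Icc 1 n,
    (1 - (β₁ * (if un n y < q.1 j then 1 else 0) +
        (if q.2 j then 0 else β₂) * (if un n x < q.1 j then 1 else 0))) with hF
  have hstep : ∀ c v : ℝ, (if c < v then (1 : ℝ) else 0) ∈ Set.Icc 0 1 := fun c v => by
    split_ifs <;> simp
  have hFm : Measurable F := by
    have hm : ∀ c : ℝ, ∀ j, Measurable fun q : (ℕ → ℝ) × (ℕ → Bool) =>
        if c < q.1 j then (1 : ℝ) else 0 := fun c j =>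
      Measurable.ite (measurableSet_lt measurable_const (by fun_prop)) measurable_const
        measurable_const
    exact measurable_prod_one_sub (fun _ => hm _ _) (fun _ => hm _ _)
      (fun j => (measurable_pi_apply j).comp measurable_snd) _ _ _
  have hFb : ∀ q, ‖F q‖ ≤ 1 := fun q =>
    norm_prod_one_sub_le (fun _ => hstep _ _) (fun _ => hstep _ _) _ hβ₁ hβ₂ hβ _
  have hXm : Measurable fun ω => fun n => X n ω := measurable_pi_lambda _ hXmeas
  have hεm : Measurable fun ω => fun n => ε n ω := measurable_pi_lambda _ hεmeas
  have hfub := integral_comp_prodMk_of_indepFun hXm hεm hindep hFm hFb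
  have hAF : ∀ ω', A ω' = ∫ ω, F (fun n => X n ω, fun n => ε n ω') ∂P := fun _ => rfl
  have hAi : Integrable A P := by
    refine .of_bound (C := 1) ?_ (ae_of_all _ fun ω' => ?_)
    · rw [funext hAF]
      have hG : Measurable fun q : Ω × Ω => F (fun n => X n q.1, fun n => ε n q.2) :=
        hFm.comp ((hXm.comp measurable_fst).prodMk (hεm.comp measurable_snd))
      exact (hG.stronglyMeasurable.integral_prod_left' (μ := P)).aestronglyMeasurable
    · rw [hAF]
      refine (norm_integral_le_of_norm_le_const (C := 1)
        (ae_of_all P fun ω => hFb (fun n => X n ω, fun n => ε n ω'))).trans ?_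
      simp
  rw [integral_prod _ hQi, Real.dist_eq, abs_sub_comm]
  change |∫ ω, F ((fun n => X n ω), fun n => ε n ω) ∂P - _| ≤ Δ
  rw [hfub]
  simp only [← hAF]
  rw [← integral_sub hAi hQi.integral_prod_left, ← Real.norm_eq_abs]
  refine (norm_integral_le_of_norm_le_const (ae_of_all _ fun ω' => hcomp ω')).trans ?_
  simp

/-- Indicators of initial segments of `ℕ` are uniform limits of polynomials in `2⁻ᴺ`. -/
lemma exists_polynomial_near_indicator_le (L : ℕ) {η : ℝ} (hη : 0 < η) :
    ∃ f : Polynomial ℝ, ∀ N : ℕ, |(if N ≤ L then 1 else 0) - f.eval ((1 / 2 : ℝ) ^ N)| ≤ η := by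
  obtain ⟨f, hf⟩ := exists_polynomial_near_of_continuousOn 0 1
    (fun s : ℝ => min 1 (max 0 ((s - (1 / 2) ^ (L + 1)) * 2 ^ (L + 1)))) (by fun_prop) η hη
  refine ⟨f, fun N => ?_⟩
  have h := (hf ((1 / 2 : ℝ) ^ N) ⟨by positivity, pow_le_one₀ (by norm_num) (by norm_num)⟩).le
  have h2 : ((1 / 2 : ℝ) ^ N - (1 / 2) ^ (L + 1)) * 2 ^ (L + 1) = (1 / 2) ^ N * 2 ^ (L + 1) - 1 := by
    rw [sub_mul, ← mul_pow]; norm_num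
  have h3 : min 1 (max 0 (((1 / 2 : ℝ) ^ N - (1 / 2) ^ (L + 1)) * 2 ^ (L + 1))) =
      if N ≤ L then 1 else 0 := by
    rw [h2]
    split_ifs with hN
    · have : (1 / 2 : ℝ) ^ L ≤ (1 / 2) ^ N := pow_le_pow_of_le_one (by norm_num) (by norm_num) hN
      have h4 : (1 / 2 : ℝ) ^ L * 2 ^ (L + 1) = 2 := by rw [pow_succ, ← mul_assoc, ← mul_pow]; norm_num
      refine min_eq_left (le_max_of_le_right ?_)
      nlinarith [pow_pos (two_pos (α := ℝ)) (L + 1)]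
    · have : (1 / 2 : ℝ) ^ N ≤ (1 / 2) ^ (L + 1) :=
        pow_le_pow_of_le_one (by norm_num) (by norm_num) (by omega)
      have h4 : (1 / 2 : ℝ) ^ (L + 1) * 2 ^ (L + 1) = 1 := by rw [← mul_pow]; norm_num
      rw [max_eq_left (by nlinarith [pow_pos (two_pos (α := ℝ)) (L + 1)])]
      simp
  rw [h3] at h
  rwa [abs_sub_comm]

lemma exists_near_indicator_le_and_le (L M : ℕ) {η : ℝ} (hη : 0 < η) :
    ∃ (s : Finset (ℕ × ℕ)) (c : ℕ × ℕ → ℝ), ∀ N₁ N₂ : ℕ,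
      |(if N₁ ≤ L ∧ N₂ ≤ M then 1 else 0) -
        ∑ p ∈ s, c p * (((1 / 2 : ℝ) ^ p.1) ^ N₁ * ((1 / 2 : ℝ) ^ p.2) ^ N₂)| ≤ η := by
  obtain ⟨θ, hθ0, hθ1, hθ⟩ : ∃ θ : ℝ, 0 < θ ∧ θ ≤ 1 ∧ 3 * θ ≤ η :=
    ⟨min 1 (η / 3), by positivity, min_le_left _ _, by linarith [min_le_right 1 (η / 3)]⟩
  obtain ⟨f₁, hf₁⟩ := exists_polynomial_near_indicator_le L hθ0
  obtain ⟨f₂, hf₂⟩ := exists_polynomial_near_indicator_le M hθ0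
  refine ⟨Finset.range (f₁.natDegree + 1) ×ˢ Finset.range (f₂.natDegree + 1),
    fun p => f₁.coeff p.1 * f₂.coeff p.2, fun N₁ N₂ => ?_⟩
  have e : ∑ p ∈ Finset.range (f₁.natDegree + 1) ×ˢ Finset.range (f₂.natDegree + 1),
      f₁.coeff p.1 * f₂.coeff p.2 * (((1 / 2 : ℝ) ^ p.1) ^ N₁ * ((1 / 2 : ℝ) ^ p.2) ^ N₂) =
      f₁.eval ((1 / 2 : ℝ) ^ N₁) * f₂.eval ((1 / 2 : ℝ) ^ N₂) := by
    rw [Polynomial.eval_eq_sum_range, Polynomial.eval_eq_sum_range, Finset.sum_mul_sum,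
      Finset.sum_product]
    refine Finset.sum_congr rfl fun p _ => Finset.sum_congr rfl fun q _ => ?_
    rw [pow_right_comm _ N₁, pow_right_comm _ N₂]
    ring
  have h₁ := abs_le.1 (hf₁ N₁)
  have h₂ := abs_le.1 (hf₂ N₂)
  rw [e]
  generalize f₁.eval ((1 / 2 : ℝ) ^ N₁) = u at h₁ ⊢
  generalize f₂.eval ((1 / 2 : ℝ) ^ N₂) = v at h₂ ⊢
  rw [abs_le]
  by_cases a : N₁ ≤ L <;> by_cases b : N₂ ≤ M <;>
    simp only [a, b, if_true, if_false, and_self, and_false, false_and] at h₁ h₂ ⊢ <;>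
    constructor <;> nlinarith

lemma hasSum_mul_of_nonneg {ι κ : Type*} {f : ι → ℝ} {h : κ → ℝ} {a b : ℝ} (hf : HasSum f a)
    (hh : HasSum h b) (hf0 : ∀ i, 0 ≤ f i) (hh0 : ∀ i, 0 ≤ h i) :
    HasSum (fun p : ι × κ => f p.1 * h p.2) (a * b) :=
  hf.mul hh (hf.summable.mul_of_nonneg hh.summable hf0 hh0)

lemma hasSum_exp_mul_exp_mul_exp {A B C : ℝ} (hA : 0 ≤ A) (hB : 0 ≤ B) (hC : 0 ≤ C) :
    HasSum (fun p : ℕ × ℕ × ℕ => A ^ p.1 / (p.1.factorial : ℝ) *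
      (B ^ p.2.1 / (p.2.1.factorial : ℝ) * (C ^ p.2.2 / (p.2.2.factorial : ℝ))))
      (exp A * (exp B * exp C)) := by
  have h : ∀ D : ℝ, HasSum (fun n : ℕ => D ^ n / (n.factorial : ℝ)) (exp D) := fun D => by
    rw [Real.exp_eq_exp_ℝ]; exact NormedSpace.expSeries_div_hasSum_exp D
  have h0 : ∀ D : ℝ, 0 ≤ D → ∀ n : ℕ, 0 ≤ D ^ n / (n.factorial : ℝ) :=
    fun D hD n => by positivity
  exact hasSum_mul_of_nonneg (h A) (hasSum_mul_of_nonneg (h B) (h C) (h0 B hB) (h0 C hC)) (h0 A hA)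
    fun p => mul_nonneg (h0 B hB _) (h0 C hC _)

/-- The weight `(t, j, k) ↦ e^{-(A+B+C)} A^t/t! B^j/j! C^k/k!` of three independent Poisson
variables, approximated through generating functions. -/
lemma abs_sum_poisson_sub_le {A B C η : ℝ} (hA : 0 ≤ A) (hB : 0 ≤ B) (hC : 0 ≤ C) {L M : ℕ}
    {s : Finset (ℕ × ℕ)} {c : ℕ × ℕ → ℝ} (hs : ∀ N₁ N₂ : ℕ,
      |(if N₁ ≤ L ∧ N₂ ≤ M then 1 else 0) -
        ∑ p ∈ s, c p * (((1 / 2 : ℝ) ^ p.1) ^ N₁ * ((1 / 2 : ℝ) ^ p.2) ^ N₂)| ≤ η) :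
    |∑ t ∈ Finset.range (M + 1), ∑ i ∈ Finset.range (M + 1 - t), ∑ j ∈ Finset.range (min i L + 1),
        A ^ t / (t.factorial : ℝ) * exp (-(A + B + C)) *
          (B ^ j / (j.factorial : ℝ) * (C ^ (i - j) / ((i - j).factorial : ℝ))) -
      ∑ p ∈ s, c p * exp (-((1 - (1 / 2) ^ p.2) * (A + B + C)) -
        (1 / 2) ^ p.2 * (1 - (1 / 2) ^ p.1) * B)| ≤ η := by
  set w : ℕ × ℕ × ℕ → ℝ := fun p => exp (-(A + B + C)) * (A ^ p.1 / (p.1.factorial : ℝ) *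
      (B ^ p.2.1 / (p.2.1.factorial : ℝ) * (C ^ p.2.2 / (p.2.2.factorial : ℝ)))) with hw
  have hw0 : ∀ p, 0 ≤ w p := fun p => by positivity
  have hw1 : HasSum w 1 := by
    have := (hasSum_exp_mul_exp_mul_exp hA hB hC).mul_left (exp (-(A + B + C)))
    rwa [← exp_add, ← exp_add, ← exp_add, show -(A + B + C) + (A + (B + C)) = 0 by ring,
      exp_zero] at this
  have hgen : ∀ a b : ℝ, 0 ≤ a → 0 ≤ b →
      HasSum (fun p : ℕ × ℕ × ℕ => w p * (a ^ p.2.1 * b ^ (p.1 + p.2.1 + p.2.2)))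
        (exp (-((1 - b) * (A + B + C)) - b * (1 - a) * B)) := by
    intro a b ha hb
    have := (hasSum_exp_mul_exp_mul_exp (mul_nonneg hA hb) (mul_nonneg hB (mul_nonneg ha hb))
      (mul_nonneg hC hb)).mul_left (exp (-(A + B + C)))
    rw [← exp_add, ← exp_add, ← exp_add, show -(A + B + C) + (A * b + (B * (a * b) + C * b)) =
      -((1 - b) * (A + B + C)) - b * (1 - a) * B by ring] at this
    refine this.congr_fun fun p => ?_
    simp only [hw, mul_pow, pow_add]
    ring
  have hψ : HasSum (fun p : ℕ × ℕ × ℕ => ∑ q ∈ s, c q * (w p *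
      (((1 / 2 : ℝ) ^ q.1) ^ p.2.1 * ((1 / 2 : ℝ) ^ q.2) ^ (p.1 + p.2.1 + p.2.2))))
      (∑ p ∈ s, c p * exp (-((1 - (1 / 2) ^ p.2) * (A + B + C)) -
        (1 / 2) ^ p.2 * (1 - (1 / 2) ^ p.1) * B)) :=
    hasSum_sum fun q _ => (hgen _ _ (by positivity) (by positivity)).mul_left _
  have hT : HasSum (fun p : ℕ × ℕ × ℕ =>
      if p.2.1 ≤ L ∧ p.1 + p.2.1 + p.2.2 ≤ M then w p else 0)
      (∑ t ∈ Finset.range (M + 1), ∑ i ∈ Finset.range (M + 1 - t),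
        ∑ j ∈ Finset.range (min i L + 1), A ^ t / (t.factorial : ℝ) * exp (-(A + B + C)) *
          (B ^ j / (j.factorial : ℝ) * (C ^ (i - j) / ((i - j).factorial : ℝ)))) := by
    have hsub : (∑ t ∈ Finset.range (M + 1), ∑ i ∈ Finset.range (M + 1 - t),
        ∑ j ∈ Finset.range (min i L + 1), A ^ t / (t.factorial : ℝ) * exp (-(A + B + C)) *
          (B ^ j / (j.factorial : ℝ) * (C ^ (i - j) / ((i - j).factorial : ℝ)))) =
        ∑ p ∈ (Finset.range (M + 1) ×ˢ Finset.range (M + 1) ×ˢ Finset.range (M + 1)).filter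
          (fun p => p.2.1 ≤ L ∧ p.1 + p.2.1 + p.2.2 ≤ M), w p := by
      simp only [Finset.sum_sigma']
      refine Finset.sum_nbij' (fun q => (q.1, q.2.2, q.2.1 - q.2.2))
        (fun p => ⟨p.1, p.2.1 + p.2.2, p.2.1⟩) ?_ ?_ ?_ ?_ ?_
      · rintro ⟨t, i, j⟩ h
        simp only [Finset.mem_sigma, Finset.mem_range, Finset.mem_filter,
          Finset.mem_product] at h ⊢
        omega
      · rintro ⟨t, j, k⟩ h
        simp only [Finset.mem_sigma, Finset.mem_range, Finset.mem_filter,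
          Finset.mem_product] at h ⊢
        omega
      · rintro ⟨t, i, j⟩ h
        simp only [Finset.mem_sigma, Finset.mem_range] at h
        have : j + (i - j) = i := by omega
        simp [this]
      · rintro ⟨t, j, k⟩ h
        simp
      · rintro ⟨t, i, j⟩ h
        simp only [hw]
        ring
    rw [hsub, Finset.sum_filter]
    refine hasSum_sum_of_ne_finset_zero fun p hp => if_neg fun h => hp ?_
    simp only [Finset.mem_product, Finset.mem_range]
    omega
  refine (hT.sub hψ).norm_le_of_bounded (by simpa using hw1.mul_right η) fun p => ?_
  have := mul_le_mul_of_nonneg_left (hs p.2.1 (p.1 + p.2.1 + p.2.2)) (hw0 p)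
  rw [Real.norm_eq_abs]
  refine le_of_eq_of_le ?_ this
  rw [← abs_of_nonneg (hw0 p), ← abs_mul, abs_of_nonneg (hw0 p), mul_sub, mul_ite, mul_one,
    mul_zero, Finset.mul_sum]
  congr 2
  exact Finset.sum_congr rfl fun q _ => mul_left_comm _ _ _

lemma measurable_card_filter {Ω : Type*} [MeasurableSpace Ω] (s : Finset ℕ) {p : ℕ → Ω → Prop}
    [∀ j ω, Decidable (p j ω)]     (hp : ∀ j, MeasurableSet {ω | p j ω}) :
    Measurable fun ω => (s.filter fun j => p j ω).card := by
  simp only [Finset.card_filter]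
  exact Finset.measurable_sum _ fun j _ => Measurable.ite (hp j) measurable_const measurable_const

lemma pow_card_mul_pow_card (s : Finset ℕ) (p q : ℕ → Prop) (hpq : ∀ j, p j → q j) (e : ℕ → Bool)
    (a b : ℝ) :
    a ^ (s.filter fun j => p j ∧ e j = false).card * b ^ (s.filter fun j => q j).card =
      ∏ j ∈ s, (1 - ((1 - b) * (if q j then 1 else 0) +
        (if e j then 0 else b * (1 - a)) * (if p j then 1 else 0))) := by
  rw [← Finset.prod_const, ← Finset.prod_const, Finset.prod_filter, Finset.prod_filter,
    ← Finset.prod_mul_distrib]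
  refine Finset.prod_congr rfl fun j _ => ?_
  by_cases hp : p j
  · cases e j <;> simp [hp, hpq j hp]
    ring
  · by_cases hq : q j <;> simp [hp, hq]

lemma integrable_poisson_term {Ω : Type*} [MeasurableSpace Ω] {P : Measure Ω}
    [IsProbabilityMeasure P] {lam : Ω → ℝ} (hlam : Measurable lam)
    (hlam01 : ∀ᵐ ω ∂P, lam ω ∈ Set.Icc (0 : ℝ) 1) {γ x y : ℝ} (hxy : y ≤ x) (t j k : ℕ) :
    Integrable (fun p : Ω × ℝ => (lam p.1 * g γ y p.2) ^ t / (t.factorial : ℝ) *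
        exp (-(g γ y p.2)) * (((1 - lam p.1) * g γ x p.2) ^ j / (j.factorial : ℝ) *
          (((1 - lam p.1) * (g γ y p.2 - g γ x p.2)) ^ k / (k.factorial : ℝ))))
      (P.prod (gaussianReal 0 1)) := by
  have hm : Measurable fun p : Ω × ℝ => lam p.1 := hlam.comp measurable_fst
  refine .of_bound (C := 1) (Measurable.aestronglyMeasurable ?_) ?_
  · simp only [g]; fun_prop
  · filter_upwards [Measure.quasiMeasurePreserving_fst.ae hlam01] with p hp
    have hg : g γ x p.2 ≤ g γ y p.2 := by simp only [g]; gcongr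
    have hg0 : 0 < g γ x p.2 := exp_pos _
    have hA : 0 ≤ lam p.1 * g γ y p.2 := mul_nonneg hp.1 (by linarith)
    have hB : 0 ≤ (1 - lam p.1) * g γ x p.2 := mul_nonneg (by linarith [hp.2]) hg0.le
    have hC : 0 ≤ (1 - lam p.1) * (g γ y p.2 - g γ x p.2) :=
      mul_nonneg (by linarith [hp.2]) (by linarith)
    have h := le_hasSum (hasSum_exp_mul_exp_mul_exp hA hB hC) (t, j, k) fun _ _ => by positivity
    rw [Real.norm_eq_abs, abs_of_nonneg (by positivity), mul_right_comm]
    refine (mul_le_mul_of_nonneg_right h (exp_pos _).le).trans_eq ?_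
    rw [← exp_add, ← exp_add, ← exp_add, exp_eq_one_iff]
    ring

lemma integrable_exp_neg {Ω : Type*} [MeasurableSpace Ω] {P : Measure Ω}
    [IsProbabilityMeasure P] {lam : Ω → ℝ} (hlam : Measurable lam)
    (hlam01 : ∀ᵐ ω ∂P, lam ω ∈ Set.Icc (0 : ℝ) 1) {γ x y β₁ β₂ : ℝ} (hβ₁ : 0 ≤ β₁) (hβ₂ : 0 ≤ β₂) :
    Integrable (fun q : Ω × ℝ => exp (-(β₁ * g γ y q.2) - (1 - lam q.1) * (β₂ * g γ x q.2)))
      (P.prod (gaussianReal 0 1)) := by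
  have hm : Measurable fun p : Ω × ℝ => lam p.1 := hlam.comp measurable_fst
  refine .of_bound (C := 1) (Measurable.aestronglyMeasurable ?_) ?_
  · simp only [g]; fun_prop
  · filter_upwards [Measure.quasiMeasurePreserving_fst.ae hlam01] with q hq
    rw [Real.norm_eq_abs, abs_of_pos (exp_pos _), exp_le_one_iff]
    have hx : 0 < g γ x q.2 := exp_pos _
    have hy : 0 < g γ y q.2 := exp_pos _
    have hl : 0 ≤ 1 - lam q.1 := by linarith [hq.2]
    have : 0 ≤ β₁ * g γ y q.2 := by positivity
    have : 0 ≤ (1 - lam q.1) * (β₂ * g γ x q.2) := by positivity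
    linarith

/-- Convergence of joint generating functions implies convergence of joint distribution functions,
with the limit described through uniform approximation. -/
lemma tendsto_measure_le_and_le_of_generating {Ω : Type*} [MeasurableSpace Ω] {P : Measure Ω}
    [IsProbabilityMeasure P] {N₁ N₂ : ℕ → Ω → ℕ} (hN₁m : ∀ n, Measurable (N₁ n))
    (hN₂m : ∀ n, Measurable (N₂ n)) {G : ℕ × ℕ → ℝ}
    (hG : ∀ p : ℕ × ℕ, Tendsto
      (fun n => ∫ ω, ((1 / 2 : ℝ) ^ p.1) ^ N₁ n ω * ((1 / 2 : ℝ) ^ p.2) ^ N₂ n ω ∂P) atTop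
      (nhds (G p))) {L M : ℕ} {T : ℝ}
    (hT : ∀ (s : Finset (ℕ × ℕ)) (c : ℕ × ℕ → ℝ) (η : ℝ), (∀ a b : ℕ,
      |(if a ≤ L ∧ b ≤ M then 1 else 0) -
        ∑ p ∈ s, c p * (((1 / 2 : ℝ) ^ p.1) ^ a * ((1 / 2 : ℝ) ^ p.2) ^ b)| ≤ η) →
      |T - ∑ p ∈ s, c p * G p| ≤ η) :
    Tendsto (fun n => (P {ω | N₁ n ω ≤ L ∧ N₂ n ω ≤ M}).toReal) atTop (nhds T) := by
  have hgfi : ∀ (p : ℕ × ℕ) n, Integrable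
      (fun ω => ((1 / 2 : ℝ) ^ p.1) ^ N₁ n ω * ((1 / 2 : ℝ) ^ p.2) ^ N₂ n ω) P := by
    intro p n
    refine .of_bound (C := 1) (Measurable.aestronglyMeasurable ?_) (ae_of_all _ fun ω => ?_)
    · exact ((measurable_from_nat (f := fun k => ((1 / 2 : ℝ) ^ p.1) ^ k)).comp (hN₁m n)).mul
        ((measurable_from_nat (f := fun k => ((1 / 2 : ℝ) ^ p.2) ^ k)).comp (hN₂m n))
    · rw [Real.norm_eq_abs, abs_of_nonneg (by positivity)]
      have h : ∀ a b : ℕ, ((1 / 2 : ℝ) ^ a) ^ b ≤ 1 := fun a b =>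
        pow_le_one₀ (by positivity) (pow_le_one₀ (by norm_num) (by norm_num))
      exact mul_le_one₀ (h _ _) (by positivity) (h _ _)
  have hNm : ∀ n, MeasurableSet {ω | N₁ n ω ≤ L ∧ N₂ n ω ≤ M} := fun n =>
    (hN₁m n measurableSet_Iic).inter (hN₂m n measurableSet_Iic)
  rw [Metric.tendsto_nhds]
  intro η hη
  obtain ⟨s, c, hs⟩ := exists_near_indicator_le_and_le L M (η := η / 3) (by positivity)
  have hTs := hT s c _ hs
  have hlim := tendsto_finsetSum s fun p _ => (hG p).const_mul (c p)
  filter_upwards [Metric.tendsto_nhds.1 hlim (η / 3) (by positivity)] with n hn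
  have e : (P {ω | N₁ n ω ≤ L ∧ N₂ n ω ≤ M}).toReal =
      ∫ ω, (if N₁ n ω ≤ L ∧ N₂ n ω ≤ M then 1 else 0) ∂P := by
    rw [← measureReal_def, ← integral_indicator_one (hNm n)]
    refine integral_congr_ae (ae_of_all _ fun ω => ?_)
    simp [Set.indicator_apply]
  have hP : |(P {ω | N₁ n ω ≤ L ∧ N₂ n ω ≤ M}).toReal - ∑ p ∈ s, c p *
      ∫ ω, ((1 / 2 : ℝ) ^ p.1) ^ N₁ n ω * ((1 / 2 : ℝ) ^ p.2) ^ N₂ n ω ∂P| ≤ η / 3 := by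
    simp only [e, ← integral_const_mul]
    rw [← integral_finsetSum _ fun p _ => (hgfi p n).const_mul _, ← integral_sub
      (.of_bound (C := 1) (Measurable.ite (hNm n) measurable_const
        measurable_const).aestronglyMeasurable (ae_of_all _ fun ω => by split_ifs <;> simp))
      (integrable_finsetSum _ fun p _ => (hgfi p n).const_mul _), ← Real.norm_eq_abs]
    refine (norm_integral_le_of_norm_le_const (ae_of_all P fun ω => hs (N₁ n ω) (N₂ n ω))).trans ?_
    simp
  rw [Real.dist_eq] at hn ⊢
  rw [abs_le] at hP hTs
  rw [abs_lt] at hn ⊢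
  constructor <;> linarith [hP.1, hP.2, hTs.1, hTs.2, hn.1, hn.2]

theorem stmt4
    {Ω : Type} [MeasurableSpace Ω] (P : Measure Ω) [IsProbabilityMeasure P]
    (X : ℕ → Ω → ℝ) (ε : ℕ → Ω → Bool) (lam : Ω → ℝ) (γ : ℝ)
    (hγ : 0 ≤ γ)
    (hXmeas : ∀ n, Measurable (X n))
    (hεmeas : ∀ n, Measurable (ε n))
    (hlam : Measurable lam)
    -- every finite-dimensional distribution of `X` is centered Gaussian
    (hGauss : ∀ (m : ℕ) (idx : Fin m → ℕ) (c : Fin m → ℝ), ∃ v : ℝ≥0,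
      Measure.map (fun ω => ∑ i, c i * X (idx i) ω) P = gaussianReal 0 v)
    -- each `X n` is standard Gaussian
    (hstd : ∀ n, Measure.map (X n) P = gaussianReal 0 1)
    -- stationarity
    (hstat : ∀ (m k : ℕ),
      Measure.map (fun ω => fun i : Fin m => X (i.1 + 1 + k) ω) P =
        Measure.map (fun ω => fun i : Fin m => X (i.1 + 1) ω) P)
    -- `r_n ln n → γ`
    (hr : Tendsto (fun n : ℕ => (∫ ω, X 1 ω * X (n + 1) ω ∂P) * Real.log n)
      atTop (nhds γ))
    -- independence of the sequences `X` and `ε`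
    (hindep : IndepFun (fun ω => fun n => X n ω) (fun ω => fun n => ε n ω) P)
    (hlam01 : ∀ᵐ ω ∂P, lam ω ∈ Set.Icc (0 : ℝ) 1)
    -- `S_n / n → λ` in probability
    (hS : TendstoInMeasure P
      (fun n ω => (∑ k ∈ Finset.Icc 1 n, (if ε k ω then (1 : ℝ) else 0)) / n)
      atTop lam)
    (l m : ℕ) (hl : 1 ≤ l) (hm : 1 ≤ m) (x y : ℝ) (hxy : y ≤ x) :
    Tendsto (fun n : ℕ =>
      (P {ω | ((Finset.Icc 1 n).filter
            (fun j => un n x < X j ω ∧ ε j ω = false)).card ≤ l - 1 ∧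
          ((Finset.Icc 1 n).filter (fun j => un n y < X j ω)).card ≤ m - 1}).toReal)
      atTop
      (nhds (∑ t ∈ Finset.range m, ∑ i ∈ Finset.range (m - t),
          ∑ j ∈ Finset.range (min i (l - 1) + 1),
        ∫ ω, ∫ z,
          (lam ω * g γ y z) ^ t / (Nat.factorial t : ℝ) *
            Real.exp (-(g γ y z)) *
          (((1 - lam ω) * g γ x z) ^ j / (Nat.factorial j : ℝ) *
            (((1 - lam ω) * (g γ y z - g γ x z)) ^ (i - j) / (Nat.factorial (i - j) : ℝ)))
          ∂(gaussianReal 0 1) ∂P)) := by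
  obtain ⟨L, rfl⟩ : ∃ L, l = L + 1 := ⟨l - 1, by omega⟩
  obtain ⟨M, rfl⟩ : ∃ M, m = M + 1 := ⟨m - 1, by omega⟩
  simp only [Nat.add_sub_cancel]
  have hterm := fun t j k => integrable_poisson_term (P := P) hlam hlam01 (γ := γ) hxy t j k
  have hlimit := fun t j k => integral_prod _ (hterm t j k)
  simp only [← hlimit]
  simp only [← integral_finsetSum _ fun j _ => hterm _ j _,
    ← integral_finsetSum _ fun i _ => integrable_finsetSum _ fun j _ => hterm _ j (i - j),
    ← integral_finsetSum _ fun t _ => integrable_finsetSum _ fun i _ =>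
      integrable_finsetSum _ fun j _ => hterm t j (i - j)]
  set N₁ : ℕ → Ω → ℕ := fun n ω => ((Finset.Icc 1 n).filter
    (fun j => un n x < X j ω ∧ ε j ω = false)).card with hN₁
  set N₂ : ℕ → Ω → ℕ := fun n ω => ((Finset.Icc 1 n).filter (fun j => un n y < X j ω)).card with hN₂
  have hN₁m : ∀ n, Measurable (N₁ n) := fun n => measurable_card_filter _
    (p := fun j ω => un n x < X j ω ∧ ε j ω = false) fun j =>
    (measurableSet_lt measurable_const (hXmeas j)).inter (hεmeas j (measurableSet_singleton false))
  have hN₂m : ∀ n, Measurable (N₂ n) := fun n => measurable_card_filter _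
    (p := fun j ω => un n y < X j ω) fun j => measurableSet_lt measurable_const (hXmeas j)
  have hgf : ∀ p : ℕ × ℕ, Tendsto
      (fun n => ∫ ω, ((1 / 2 : ℝ) ^ p.1) ^ N₁ n ω * ((1 / 2 : ℝ) ^ p.2) ^ N₂ n ω ∂P) atTop
      (nhds (∫ q : Ω × ℝ, exp (-((1 - (1 / 2) ^ p.2) * g γ y q.2) -
        (1 - lam q.1) * ((1 / 2) ^ p.2 * (1 - (1 / 2) ^ p.1) * g γ x q.2))
        ∂(P.prod (gaussianReal 0 1)))) := by
    intro p
    have ha : (1 / 2 : ℝ) ^ p.1 ≤ 1 := pow_le_one₀ (by norm_num) (by norm_num)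
    have hb : (1 / 2 : ℝ) ^ p.2 ≤ 1 := pow_le_one₀ (by norm_num) (by norm_num)
    have hb0 : 0 < (1 / 2 : ℝ) ^ p.2 := by positivity
    have ha0 : 0 < (1 / 2 : ℝ) ^ p.1 := by positivity
    refine (tendsto_integral_prod_one_sub hγ hXmeas hεmeas hGauss hstd hstat hr hindep hS hxy
      (β₁ := 1 - (1 / 2) ^ p.2) (β₂ := (1 / 2) ^ p.2 * (1 - (1 / 2) ^ p.1)) (by linarith)
      (mul_nonneg hb0.le (by linarith)) (by nlinarith)).congr fun n => ?_
    refine integral_congr_ae (ae_of_all _ fun ω => ?_)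
    exact (pow_card_mul_pow_card (Finset.Icc 1 n) (fun j => un n x < X j ω)
      (fun j => un n y < X j ω) (fun j hj => (un_le_un n hxy).trans_lt hj) (fun j => ε j ω) _ _).symm
  refine tendsto_measure_le_and_le_of_generating hN₁m hN₂m hgf fun s c η hs => ?_
  simp only [← integral_const_mul]
  rw [← integral_finsetSum _ fun p _ => (integrable_exp_neg hlam hlam01
      (sub_nonneg.2 (pow_le_one₀ (by norm_num) (by norm_num)))
      (mul_nonneg (by positivity) (sub_nonneg.2 (pow_le_one₀ (by norm_num) (by norm_num))))).const_mul _,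
    ← integral_sub (integrable_finsetSum _ fun t _ => integrable_finsetSum _ fun i _ =>
      integrable_finsetSum _ fun j _ => hterm t j (i - j))
      (integrable_finsetSum _ fun p _ => (integrable_exp_neg hlam hlam01
      (sub_nonneg.2 (pow_le_one₀ (by norm_num) (by norm_num)))
      (mul_nonneg (by positivity) (sub_nonneg.2 (pow_le_one₀ (by norm_num) (by norm_num))))).const_mul _),
    ← Real.norm_eq_abs]
  refine (norm_integral_le_of_norm_le_const (C := η) ?_).trans (by simp)
  filter_upwards [Measure.quasiMeasurePreserving_fst.ae hlam01] with q hq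
  have hg : g γ x q.2 ≤ g γ y q.2 := by simp only [g]; gcongr
  have hg0 : 0 < g γ x q.2 := exp_pos _
  have hl1 : 0 ≤ 1 - lam q.1 := sub_nonneg.2 hq.2
  have h := abs_sum_poisson_sub_le (mul_nonneg hq.1 (hg0.le.trans hg)) (mul_nonneg hl1 hg0.le)
    (mul_nonneg hl1 (sub_nonneg.2 hg)) hs
  have hsum : lam q.1 * g γ y q.2 + (1 - lam q.1) * g γ x q.2 +
      (1 - lam q.1) * (g γ y q.2 - g γ x q.2) = g γ y q.2 := by ring
  rw [hsum] at h
  rw [Real.norm_eq_abs]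
  have hre : ∀ p : ℕ × ℕ,
      (1 - lam q.1) * ((1 / 2) ^ p.2 * (1 - (1 / 2) ^ p.1) * g γ x q.2) =
        (1 / 2) ^ p.2 * (1 - (1 / 2) ^ p.1) * ((1 - lam q.1) * g γ x q.2) :=
    fun p => mul_left_comm _ _ _
  simp only [hre]
  exact h
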